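/- arXiv:2602.12471 — 6 statements merged into one kernel-verified Lean document; each statement's English description precedes it below -/
import Mathlib

section
/- Suppose η ≥ η₀ = max(n, (32/γ²)·log(256/γ²)), the transition time τ = min{t ≥ 0 : F(w_t) ≤ 1/(8η)} exists or is set to +∞ otherwise, and t < τ. Then there exists s with t < s ≤ t + 1 + 4n/γ + 96/γ² such that either s = τ or an oscillation happens at iteration s. -/
open scoped InnerProductSpace BigOperators
open Finset

/-- Logistic loss `F(w) = (1/n) ∑ᵢ log(1 + exp(−⟨w, xᵢ⟩))`. -/
noncomputable def logisticLoss (n : ℕ) (x : Fin n → EuclideanSpace ℝ (Fin 2))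
    (w : EuclideanSpace ℝ (Fin 2)) : ℝ :=
  (n : ℝ)⁻¹ * ∑ i, Real.log (1 + Real.exp (-⟪w, x i⟫_ℝ))

/-- Gradient potential `G(w) = (1/n) ∑ᵢ 1/(exp(⟨w, xᵢ⟩) + 1)`. -/
noncomputable def gradPotential (n : ℕ) (x : Fin n → EuclideanSpace ℝ (Fin 2))
    (w : EuclideanSpace ℝ (Fin 2)) : ℝ :=
  (n : ℝ)⁻¹ * ∑ i, (Real.exp ⟪w, x i⟫_ℝ + 1)⁻¹

/-- Gradient descent iterates: `w₀ = 0`, `w_{t+1} = w_t − η ∇F(w_t)`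
(the gradient of the logistic loss is written in closed form). -/
noncomputable def gdIter (n : ℕ) (x : Fin n → EuclideanSpace ℝ (Fin 2)) (η : ℝ) :
    ℕ → EuclideanSpace ℝ (Fin 2)
  | 0 => 0
  | t + 1 => gdIter n x η t
      + (η / n) • ∑ i, (Real.exp ⟪gdIter n x η t, x i⟫_ℝ + 1)⁻¹ • x i

/-- `γ` is the maximum margin of the dataset `x`:
it is the greatest `m` such that some unit vector `w` satisfies `⟨w, xᵢ⟩ ≥ m` for all `i`. -/
def isMaxMargin (n : ℕ) (x : Fin n → EuclideanSpace ℝ (Fin 2)) (γ : ℝ) : Prop :=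
  IsGreatest {m : ℝ | ∃ w : EuclideanSpace ℝ (Fin 2), ‖w‖ = 1 ∧ ∀ i, m ≤ ⟪w, x i⟫_ℝ} γ

/-- The threshold `λ = log(1/(exp(1/(8η)) − 1))/γ`. -/
noncomputable def lambdaThresh (γ η : ℝ) : ℝ :=
  Real.log (1 / (Real.exp (1 / (8 * η)) - 1)) / γ

/-- An oscillation occurs at iteration `t` if `ŵ_t ≥ λ`, `F(w_t) > 1/(8η)`,
`F(w_{t+1}) > 1/(8η)`, and `w̃_{t+1}·w̃_t < 0`. -/
def oscillationAt (n : ℕ) (x : Fin n → EuclideanSpace ℝ (Fin 2)) (γ η : ℝ)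
    (wst vst : EuclideanSpace ℝ (Fin 2)) (t : ℕ) : Prop :=
  lambdaThresh γ η ≤ ⟪gdIter n x η t, wst⟫_ℝ ∧
  1 / (8 * η) < logisticLoss n x (gdIter n x η t) ∧
  1 / (8 * η) < logisticLoss n x (gdIter n x η (t + 1)) ∧
  ⟪gdIter n x η (t + 1), vst⟫_ℝ * ⟪gdIter n x η t, vst⟫_ℝ < 0

open Real in
lemma mul_exp_neg_le_of_large_step {γ η : ℝ} (hγ : 0 < γ) (hη0 : 0 ≤ η)
    (hη : 32 / γ ^ 2 * log (256 / γ ^ 2) ≤ η) :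
    η * exp (-(η * γ ^ 2 / 2)) ≤ γ ^ 2 / 64 := by
  have hγ2 : 0 < γ ^ 2 := by positivity
  set u := η * γ ^ 2 with hu
  have hlog : log (256 / γ ^ 2) ≤ u / 32 := by
    have h := mul_le_mul_of_nonneg_right hη hγ2.le
    have e : 32 / γ ^ 2 * log (256 / γ ^ 2) * γ ^ 2 = 32 * log (256 / γ ^ 2) := by
      field_simp
    rw [e] at h
    linarith
  have hq : 256 / γ ^ 2 ≤ exp (u / 32) := (log_le_iff_le_exp (by positivity)).1 hlog
  have hq' : 256 ≤ exp (u / 32) * γ ^ 2 := (div_le_iff₀ hγ2).1 hq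
  have h1 : u / 16 ≤ exp (u / 16) := by linarith [add_one_le_exp (u / 16)]
  have hsq : exp (u / 16) = exp (u / 32) ^ 2 := by
    rw [← exp_nat_mul]; congr 1; push_cast; ring
  have hfour : exp (u / 8) = exp (u / 16) * exp (u / 16) := by
    rw [← exp_add]; congr 1; ring
  have hq2 : 256 ^ 2 ≤ exp (u / 16) * γ ^ 4 := by
    calc (256 : ℝ) ^ 2 ≤ (exp (u / 32) * γ ^ 2) ^ 2 := by gcongr
      _ = exp (u / 16) * γ ^ 4 := by rw [hsq]; ring
  have hu0 : 0 ≤ u := by positivity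
  have h8 : exp (u / 8) ≤ exp (u / 2) := exp_le_exp.2 (by linarith)
  rw [exp_neg, ← div_eq_mul_inv, div_le_iff₀ (exp_pos _)]
  have hfin : 64 * u ≤ γ ^ 4 * exp (u / 2) := by
    calc 64 * u ≤ 256 ^ 2 * exp (u / 16) := by nlinarith [exp_pos (u / 16)]
      _ ≤ exp (u / 16) * γ ^ 4 * exp (u / 16) := by gcongr
      _ = γ ^ 4 * exp (u / 8) := by rw [hfour]; ring
      _ ≤ γ ^ 4 * exp (u / 2) := by gcongr
  have : γ ^ 2 * (64 * η) ≤ γ ^ 2 * (γ ^ 2 * exp (u / 2)) := by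
    calc γ ^ 2 * (64 * η) = 64 * u := by rw [hu]; ring
      _ ≤ _ := hfin
      _ = _ := by ring
  linarith [le_of_mul_le_mul_left this hγ2]

/-- The margin `⟨w_s, x_i⟩` in planar coordinates, where `w_s = (A s, B s)` and
`x_i = (a i, b i)`. -/
def planarMargin {n : ℕ} (a b : Fin n → ℝ) (A B : ℕ → ℝ) (s : ℕ) (i : Fin n) : ℝ :=
  A s * a i + B s * b i

/-- Gradient descent on the logistic loss of a planar separable dataset, in the coordinates in
which the first axis is a separating direction, with a step size that is large enough. -/
structure PlanarDescent (n : ℕ) (a b : Fin n → ℝ) (γ η : ℝ) (A B : ℕ → ℝ) : Prop where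
  n_pos : 0 < n
  n_le : (n : ℝ) ≤ η
  γ_pos : 0 < γ
  noise : η * Real.exp (-(η * γ ^ 2 / 2)) ≤ γ ^ 2 / 64
  sep : ∀ i, γ ≤ a i
  norm_le : ∀ i, a i ^ 2 + b i ^ 2 ≤ 1
  A_zero : A 0 = 0
  B_zero : B 0 = 0
  A_succ : ∀ s, A (s + 1) =
    A s + η / n * ∑ i, (Real.exp (planarMargin a b A B s i) + 1)⁻¹ * a i
  B_succ : ∀ s, B (s + 1) =
    B s + η / n * ∑ i, (Real.exp (planarMargin a b A B s i) + 1)⁻¹ * b i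

namespace PlanarDescent

open Real

variable {n : ℕ} {a b : Fin n → ℝ} {γ η : ℝ} {A B : ℕ → ℝ}

lemma sigmoid_le_exp_neg (m : ℝ) : (exp m + 1)⁻¹ ≤ exp (-m) := by
  rw [exp_neg]
  exact inv_anti₀ (exp_pos m) (by linarith)

lemma sigmoid_pos (m : ℝ) : 0 < (exp m + 1)⁻¹ := by positivity

lemma sigmoid_le_one (m : ℝ) : (exp m + 1)⁻¹ ≤ 1 :=
  inv_le_one_of_one_le₀ (by linarith [exp_pos m])

lemma half_le_sigmoid {m : ℝ} (hm : m ≤ 0) : 1 / 2 ≤ (exp m + 1)⁻¹ := by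
  rw [one_div]
  exact inv_anti₀ (by positivity) (by linarith [exp_le_one_iff.2 hm])

lemma half_exp_neg_le_sigmoid {m : ℝ} (hm : 0 ≤ m) : exp (-m) / 2 ≤ (exp m + 1)⁻¹ := by
  rw [exp_neg, ← one_div, div_div, ← one_div]
  exact one_div_le_one_div_of_le (by positivity) (by linarith [one_le_exp hm])

lemma log_one_add_exp_neg_le (m : ℝ) : log (1 + exp (-m)) ≤ exp (-m) := by
  linarith [log_le_sub_one_of_pos (show 0 < 1 + exp (-m) by positivity)]

lemma cast_pos (h : PlanarDescent n a b γ η A B) : (0 : ℝ) < n := Nat.cast_pos.2 h.n_pos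

lemma η_pos (h : PlanarDescent n a b γ η A B) : 0 < η := h.cast_pos.trans_le h.n_le

lemma one_le_η (h : PlanarDescent n a b γ η A B) : 1 ≤ η :=
  le_trans (by exact_mod_cast h.n_pos) h.n_le

lemma b_abs_le (h : PlanarDescent n a b γ η A B) (i : Fin n) : |b i| ≤ 1 :=
  abs_le_one_iff_mul_self_le_one.2 (by nlinarith [h.norm_le i, sq_nonneg (a i)])

lemma γ_sq_le_one (h : PlanarDescent n a b γ η A B) : γ ^ 2 ≤ 1 := by
  have i : Fin n := ⟨0, h.n_pos⟩
  have := pow_le_pow_left₀ h.γ_pos.le (h.sep i) 2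
  nlinarith [h.norm_le i, sq_nonneg (b i)]

lemma reflect (h : PlanarDescent n a b γ η A B) :
    PlanarDescent n a (fun i => -b i) γ η A (fun s => -B s) where
  __ := h
  norm_le i := by simpa using h.norm_le i
  B_zero := by simp [h.B_zero]
  A_succ s := by simpa [planarMargin] using h.A_succ s
  B_succ s := by
    rw [h.B_succ s]
    simp only [planarMargin, mul_neg, neg_mul, neg_neg, Finset.sum_neg_distrib]
    ring

lemma step_mul_sum_const (h : PlanarDescent n a b γ η A B) (c : ℝ) :
    η / n * ∑ _i : Fin n, c = η * c := by
  have := h.cast_pos.ne'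
  simp only [sum_const, card_univ, Fintype.card_fin, nsmul_eq_mul]
  field_simp

lemma A_le_succ (h : PlanarDescent n a b γ η A B) (s : ℕ) : A s ≤ A (s + 1) := by
  rw [h.A_succ]
  have := h.η_pos
  have : 0 ≤ ∑ i, (exp (planarMargin a b A B s i) + 1)⁻¹ * a i :=
    sum_nonneg fun i _ => mul_nonneg (sigmoid_pos _).le (h.γ_pos.le.trans (h.sep i))
  have : 0 ≤ η / n * ∑ i, (exp (planarMargin a b A B s i) + 1)⁻¹ * a i := by positivity
  linarith

lemma half_step_le (h : PlanarDescent n a b γ η A B) {s : ℕ} (hs : 1 ≤ s) :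
    η * γ / 2 ≤ A s := by
  have hη := h.η_pos
  refine le_trans ?_ (monotone_nat_of_le_succ h.A_le_succ hs)
  rw [h.A_succ 0, h.A_zero, zero_add]
  calc η * γ / 2 = η / n * ∑ _i : Fin n, γ / 2 := by rw [h.step_mul_sum_const]; ring
    _ ≤ _ := by
      gcongr with i
      have hm : planarMargin a b A B 0 i = 0 := by simp [planarMargin, h.A_zero, h.B_zero]
      rw [hm, exp_zero]
      linarith [h.sep i]

lemma sq_div_two_le (h : PlanarDescent n a b γ η A B) {s : ℕ} (hs : 1 ≤ s) (i : Fin n) :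
    η * γ ^ 2 / 2 ≤ A s * a i := by
  have hη := h.η_pos
  have hγ := h.γ_pos
  calc η * γ ^ 2 / 2 = η * γ / 2 * γ := by ring
    _ ≤ A s * a i := mul_le_mul (h.half_step_le hs) (h.sep i) hγ.le
      ((by positivity : (0 : ℝ) ≤ η * γ / 2).trans (h.half_step_le hs))

lemma exp_neg_margin_le (h : PlanarDescent n a b γ η A B) {s : ℕ} (hs : 1 ≤ s) {i : Fin n}
    (hi : 0 ≤ B s * b i) :
    exp (-planarMargin a b A B s i) ≤ exp (-(η * γ ^ 2 / 2)) :=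
  exp_le_exp.2 (by unfold planarMargin; linarith [h.sq_div_two_le hs i])

lemma noise_le (h : PlanarDescent n a b γ η A B) :
    exp (-(η * γ ^ 2 / 2)) ≤ 1 / (64 * η) := by
  have hη := h.η_pos
  rw [le_div_iff₀ (by positivity)]
  linarith [h.noise, h.γ_sq_le_one]

/-- On the separating axis the loss is already below the threshold. -/
lemma loss_le_of_B_eq_zero (h : PlanarDescent n a b γ η A B) {s : ℕ} (hs : 1 ≤ s)
    (hB : B s = 0) :
    (n : ℝ)⁻¹ * ∑ i, log (1 + exp (-planarMargin a b A B s i)) ≤ 1 / (8 * η) := by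
  have hη := h.η_pos
  have hn := h.cast_pos
  calc _ ≤ (n : ℝ)⁻¹ * ∑ _i : Fin n, 1 / (64 * η) := by
        gcongr with i
        exact (log_one_add_exp_neg_le _).trans
          ((h.exp_neg_margin_le hs (by simp [hB])).trans h.noise_le)
    _ = 1 / (64 * η) := by
        simp only [sum_const, card_univ, Fintype.card_fin, nsmul_eq_mul]
        field_simp
    _ ≤ 1 / (8 * η) := one_div_le_one_div_of_le (by positivity) (by linarith)

lemma lambdaThresh_le (h : PlanarDescent n a b γ η A B) {s : ℕ} (hs : 1 ≤ s) :
    lambdaThresh γ η ≤ A s := by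
  have hη := h.η_pos
  have hγ := h.γ_pos
  refine le_trans ?_ (h.half_step_le hs)
  have hx : 1 / (8 * η) ≤ exp (1 / (8 * η)) - 1 := by linarith [add_one_le_exp (1 / (8 * η))]
  have hx0 : 0 < 1 / (8 * η) := by positivity
  rw [lambdaThresh, div_le_iff₀ hγ, log_le_iff_le_exp (one_div_pos.2 (hx0.trans_le hx))]
  have h64 : 64 * η ≤ exp (η * γ / 2 * γ) := by
    have := h.noise_le
    rw [exp_neg, ← one_div] at this
    have := (one_div_le_one_div (exp_pos _) (by positivity)).1 this
    rwa [show η * γ / 2 * γ = η * γ ^ 2 / 2 by ring]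
  calc 1 / (exp (1 / (8 * η)) - 1) ≤ 1 / (1 / (8 * η)) := one_div_le_one_div_of_le hx0 hx
    _ = 8 * η := by rw [one_div_one_div]
    _ ≤ _ := by linarith

/-- While a point is misclassified, the first coordinate grows by a fixed amount. -/
lemma A_succ_ge_of_misclassified (h : PlanarDescent n a b γ η A B) {s : ℕ} {j : Fin n}
    (hj : planarMargin a b A B s j < 0) : A s + η * γ / (2 * n) ≤ A (s + 1) := by
  have hη := h.η_pos
  have hn := h.cast_pos
  rw [h.A_succ]
  have hsum : γ / 2 ≤ ∑ i, (exp (planarMargin a b A B s i) + 1)⁻¹ * a i := by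
    refine le_trans ?_ (single_le_sum (fun i _ => mul_nonneg (sigmoid_pos _).le
      (h.γ_pos.le.trans (h.sep i))) (mem_univ j))
    nlinarith [half_le_sigmoid hj.le, h.sep j, h.γ_pos]
  calc A s + η * γ / (2 * n) = A s + η / n * (γ / 2) := by field_simp
    _ ≤ _ := by gcongr

/-- While a point is misclassified, the second coordinate shrinks. -/
lemma B_mul_sub_ge_of_misclassified (h : PlanarDescent n a b γ η A B) {s : ℕ} (hs : 1 ≤ s)
    {j : Fin n} (hj : planarMargin a b A B s j < 0) :
    η * γ * A s / (4 * n) ≤ B s * (B s - B (s + 1)) := by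
  have hη := h.η_pos
  have hn := h.cast_pos
  have hγ := h.γ_pos
  have hA := h.half_step_le hs
  set ε := exp (-(η * γ ^ 2 / 2)) with hε
  have hε0 : 0 < ε := exp_pos _
  have hterm : ∀ i, (if i = j then γ * A s / 2 else 0) - ε ≤
      -(B s * b i * (exp (planarMargin a b A B s i) + 1)⁻¹) := by
    intro i
    split_ifs with hij
    · subst hij
      have h1 : γ * A s ≤ -(B s * b i) := by
        unfold planarMargin at hj
        nlinarith [h.sep i, (by positivity : 0 < η * γ / 2)]
      have h2 := half_le_sigmoid hj.le
      have h3 : 0 ≤ γ * A s := mul_nonneg hγ.le ((by positivity : 0 ≤ η * γ / 2).trans hA)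
      nlinarith
    · rcases le_total 0 (B s * b i) with hb | hb
      · have h1 : (exp (planarMargin a b A B s i) + 1)⁻¹ ≤ ε * exp (-(B s * b i)) := by
          refine (sigmoid_le_exp_neg _).trans ?_
          rw [hε, ← exp_add]
          exact exp_le_exp.2 (by unfold planarMargin; linarith [h.sq_div_two_le hs i])
        have h2 : B s * b i * exp (-(B s * b i)) ≤ 1 := by
          rw [exp_neg, ← div_eq_mul_inv, div_le_one (exp_pos _)]
          linarith [add_one_le_exp (B s * b i)]
        nlinarith [mul_le_mul_of_nonneg_left h1 hb, mul_le_mul_of_nonneg_left h2 hε0.le]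
      · nlinarith [mul_nonneg (neg_nonneg.2 hb) (sigmoid_pos (planarMargin a b A B s i)).le]
  have hsum := mul_le_mul_of_nonneg_left (sum_le_sum fun i (_ : i ∈ univ) => hterm i)
    (by positivity : 0 ≤ η / n)
  rw [sum_sub_distrib, mul_sub, h.step_mul_sum_const, sum_ite_eq' univ j] at hsum
  simp only [mem_univ, if_true] at hsum
  have heq : B s * (B s - B (s + 1)) =
      η / n * ∑ i, -(B s * b i * (exp (planarMargin a b A B s i) + 1)⁻¹) := by
    rw [h.B_succ, sum_neg_distrib]
    have : ∑ i, B s * b i * (exp (planarMargin a b A B s i) + 1)⁻¹ =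
        B s * ∑ i, (exp (planarMargin a b A B s i) + 1)⁻¹ * b i := by
      rw [mul_sum]; exact sum_congr rfl fun i _ => by ring
    rw [this]; ring
  rw [heq]
  refine le_trans ?_ hsum
  have hnoise : η * ε ≤ η * γ * A s / (4 * n) := by
    rw [le_div_iff₀ (by positivity)]
    have h1 : η * γ * (η * γ / 2) ≤ η * γ * A s := by gcongr
    have h2 : η * ε * (4 * n) ≤ γ ^ 2 / 64 * (4 * η) := by
      have := h.noise
      have := h.n_le
      gcongr
    have h3 : γ ^ 2 * η * 1 ≤ γ ^ 2 * η * η := by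
      have := h.one_le_η
      gcongr
    nlinarith
  have : η / n * (γ * A s / 2) = 2 * (η * γ * A s / (4 * n)) := by field_simp; ring
  linarith

/-- The second coordinate is at most `η` right after it becomes positive. -/
lemma B_succ_le (h : PlanarDescent n a b γ η A B) {s : ℕ} (hB : B s ≤ 0) :
    B (s + 1) ≤ η := by
  have hη := h.η_pos
  have hn := h.cast_pos
  rw [h.B_succ]
  have : η / n * ∑ i, (exp (planarMargin a b A B s i) + 1)⁻¹ * b i ≤
      η / n * ∑ _i : Fin n, (1 : ℝ) := by
    gcongr with i
    nlinarith [sigmoid_pos (planarMargin a b A B s i), sigmoid_le_one (planarMargin a b A B s i),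
      abs_le.1 (h.b_abs_le i)]
  rw [h.step_mul_sum_const] at this
  linarith

/-- Misclassification persists for fewer than `4n/γ` steps on a stretch without sign change. -/
lemma misclassified_stretch_lt (h : PlanarDescent n a b γ η A B) {r k : ℕ} (hr : B r ≤ 0)
    (hpos : ∀ i ≤ k, 0 < B (r + 1 + i))
    (hmis : ∀ i < k, ∃ j, planarMargin a b A B (r + 1 + i) j < 0) :
    (k : ℝ) < 4 * n / γ := by
  have hη := h.η_pos
  have hn := h.cast_pos
  have hn1 : (1 : ℝ) ≤ n := by exact_mod_cast h.n_pos
  have hγ := h.γ_pos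
  have key : ∀ i ≤ k, η * γ * (i + n) / (2 * n) ≤ A (r + 1 + i) ∧
      B (r + 1 + i) ^ 2 ≤ η ^ 2 - η ^ 2 * γ ^ 2 * i ^ 2 / (16 * n ^ 2) := by
    intro i
    induction i with
    | zero =>
      intro h0
      refine ⟨?_, ?_⟩
      · have := h.half_step_le (s := r + 1) (by omega)
        have e : η * γ * (((0 : ℕ) : ℝ) + n) / (2 * n) = η * γ / 2 := by
          push_cast; field_simp; ring
        rw [e]; exact this
      · have h1 := hpos 0 h0
        have := pow_le_pow_left₀ h1.le (h.B_succ_le hr) 2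
        simpa using this
    | succ i ih =>
      intro hi
      obtain ⟨hA, hB⟩ := ih (by omega)
      obtain ⟨j, hj⟩ := hmis i (by omega)
      have h0 := hpos i (by omega)
      have h1 := hpos (i + 1) hi
      rw [← add_assoc] at h1 ⊢
      have hA1 := h.A_succ_ge_of_misclassified hj
      have hB1 := h.B_mul_sub_ge_of_misclassified (by omega) hj
      refine ⟨?_, ?_⟩
      · refine le_trans (le_of_eq ?_) (le_trans (add_le_add_left hA _) hA1)
        push_cast; field_simp; ring
      · have hdec : η * γ * (η * γ * (i + n) / (2 * n)) / (4 * n) ≤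
            η * γ * A (r + 1 + i) / (4 * n) := by gcongr
        have hsq : B (r + 1 + i + 1) ^ 2 ≤ B (r + 1 + i) * B (r + 1 + i + 1) := by
          have : 0 ≤ η * γ * (η * γ * (i + n) / (2 * n)) / (4 * n) := by positivity
          have : 0 ≤ B (r + 1 + i) - B (r + 1 + i + 1) :=
            nonneg_of_mul_nonneg_right (by linarith) h0
          nlinarith
        have hcmp : η ^ 2 * γ ^ 2 * (2 * i + 1) / (16 * n ^ 2) ≤
            η * γ * (η * γ * (i + n) / (2 * n)) / (4 * n) := by
          have e : η * γ * (η * γ * (i + n) / (2 * n)) / (4 * n) =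
              η ^ 2 * γ ^ 2 * (2 * i + 2 * n) / (16 * n ^ 2) := by field_simp; ring
          rw [e]
          gcongr
          linarith
        have e2 : η ^ 2 * γ ^ 2 * ((i + 1 : ℕ) : ℝ) ^ 2 / (16 * n ^ 2) =
            η ^ 2 * γ ^ 2 * i ^ 2 / (16 * n ^ 2) +
              η ^ 2 * γ ^ 2 * (2 * i + 1) / (16 * n ^ 2) := by
          push_cast; ring
        rw [e2]
        linarith
  have hk := (key k le_rfl).2
  have hBk := pow_pos (hpos k le_rfl) 2
  have h1 : η ^ 2 * γ ^ 2 * k ^ 2 / (16 * n ^ 2) < η ^ 2 := by linarith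
  rw [div_lt_iff₀ (by positivity)] at h1
  have h2 : (γ * k) ^ 2 < (4 * n) ^ 2 := by
    have : η ^ 2 * (γ * k) ^ 2 < η ^ 2 * (4 * n) ^ 2 := by nlinarith
    exact lt_of_mul_lt_mul_left this (by positivity)
  have h3 := lt_of_pow_lt_pow_left₀ 2 (by positivity) h2
  rw [lt_div_iff₀ hγ]
  linarith

/-- The exponential loss of the points on the negative side of the separating axis. -/
noncomputable def negSideLoss {n : ℕ} (a b : Fin n → ℝ) (A B : ℕ → ℝ) (s : ℕ) : ℝ :=
  (n : ℝ)⁻¹ * ∑ i, if b i < 0 then exp (-planarMargin a b A B s i) else 0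

lemma negSideLoss_ge (h : PlanarDescent n a b γ η A B) {s : ℕ} (hs : 1 ≤ s) (hB : 0 < B s)
    (hF : 1 / (8 * η) < (n : ℝ)⁻¹ * ∑ i, log (1 + exp (-planarMargin a b A B s i))) :
    1 / (16 * η) ≤ negSideLoss a b A B s := by
  have hη := h.η_pos
  have hn := h.cast_pos
  have : (n : ℝ)⁻¹ * ∑ i, log (1 + exp (-planarMargin a b A B s i)) ≤
      (n : ℝ)⁻¹ * ∑ i, ((if b i < 0 then exp (-planarMargin a b A B s i) else 0) +
        1 / (64 * η)) := by
    gcongr with i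
    refine (log_one_add_exp_neg_le _).trans ?_
    have : 0 < 1 / (64 * η) := by positivity
    split_ifs with hb
    · linarith
    · rw [zero_add]
      exact (h.exp_neg_margin_le hs (mul_nonneg hB.le (not_lt.1 hb))).trans h.noise_le
  rw [sum_add_distrib, mul_add] at this
  have e : (n : ℝ)⁻¹ * ∑ _i : Fin n, 1 / (64 * η) = 1 / (64 * η) := by
    simp only [sum_const, card_univ, Fintype.card_fin, nsmul_eq_mul]
    field_simp
  rw [e] at this
  have e1 : 1 / (8 * η) = 8 * (1 / (64 * η)) := by field_simp; norm_num
  have e2 : 1 / (16 * η) = 4 * (1 / (64 * η)) := by field_simp; norm_num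
  have : 0 < 1 / (64 * η) := by positivity
  unfold negSideLoss
  linarith

/-- While all points are classified correctly, the margins on the negative side increase. -/
lemma margin_succ_ge (h : PlanarDescent n a b γ η A B) {s : ℕ} (hs : 1 ≤ s) (hB : 0 < B s)
    (hF : 1 / (8 * η) < (n : ℝ)⁻¹ * ∑ i, log (1 + exp (-planarMargin a b A B s i)))
    (hm : ∀ i, 0 ≤ planarMargin a b A B s i) {j : Fin n} (hj : b j < 0) :
    planarMargin a b A B s j + η * γ ^ 2 / 4 * negSideLoss a b A B s ≤
      planarMargin a b A B (s + 1) j := by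
  have hη := h.η_pos
  have hn := h.cast_pos
  have hγ := h.γ_pos
  set ε := exp (-(η * γ ^ 2 / 2)) with hε
  have hε0 : 0 < ε := exp_pos _
  have hterm : ∀ i, γ ^ 2 / 2 * (if b i < 0 then exp (-planarMargin a b A B s i) else 0) - ε ≤
      (exp (planarMargin a b A B s i) + 1)⁻¹ * (a i * a j + b i * b j) := by
    intro i
    have hab : γ ^ 2 ≤ a i * a j := by nlinarith [h.sep i, h.sep j]
    split_ifs with hb
    · have h1 := half_exp_neg_le_sigmoid (hm i)
      have h2 : γ ^ 2 ≤ a i * a j + b i * b j := by nlinarith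
      have h3 := mul_le_mul h1 h2 (by positivity) (sigmoid_pos _).le
      linarith
    · have h1 : (exp (planarMargin a b A B s i) + 1)⁻¹ ≤ ε :=
        (sigmoid_le_exp_neg _).trans (h.exp_neg_margin_le hs (mul_nonneg hB.le (not_lt.1 hb)))
      have h2 : -1 ≤ b i * b j := by
        have := mul_le_mul (h.b_abs_le i) (h.b_abs_le j) (abs_nonneg _) zero_le_one
        rw [← abs_mul] at this
        linarith [neg_abs_le (b i * b j)]
      nlinarith [sigmoid_pos (planarMargin a b A B s i)]
  have hsum := mul_le_mul_of_nonneg_left (sum_le_sum fun i (_ : i ∈ univ) => hterm i)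
    (by positivity : 0 ≤ η / n)
  rw [sum_sub_distrib, mul_sub, h.step_mul_sum_const, ← mul_sum] at hsum
  have e1 : η / n * (γ ^ 2 / 2 * ∑ i, if b i < 0 then exp (-planarMargin a b A B s i) else 0) =
      η * γ ^ 2 / 2 * negSideLoss a b A B s := by
    unfold negSideLoss; ring
  have e2 : planarMargin a b A B (s + 1) j = planarMargin a b A B s j +
      η / n * ∑ i, (exp (planarMargin a b A B s i) + 1)⁻¹ * (a i * a j + b i * b j) := by
    have e3 : ∑ i, (exp (planarMargin a b A B s i) + 1)⁻¹ * (a i * a j + b i * b j) =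
        (∑ i, (exp (planarMargin a b A B s i) + 1)⁻¹ * a i) * a j +
          (∑ i, (exp (planarMargin a b A B s i) + 1)⁻¹ * b i) * b j := by
      rw [sum_mul, sum_mul, ← sum_add_distrib]
      exact sum_congr rfl fun i _ => by ring
    rw [e3]
    conv_lhs => unfold planarMargin
    rw [h.A_succ, h.B_succ]
    conv_rhs => lhs; unfold planarMargin
    ring
  rw [e1] at hsum
  rw [e2]
  have hS := h.negSideLoss_ge hs hB hF
  have hS' : γ ^ 2 / 64 ≤ η * γ ^ 2 / 4 * negSideLoss a b A B s := by
    calc γ ^ 2 / 64 = η * γ ^ 2 / 4 * (1 / (16 * η)) := by field_simp; norm_num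
      _ ≤ _ := by gcongr
  have := h.noise
  linarith

lemma inv_negSideLoss_succ_ge (h : PlanarDescent n a b γ η A B) {s : ℕ} (hs : 1 ≤ s)
    (hB : 0 < B s) (hpos : 0 < negSideLoss a b A B (s + 1))
    (hF : 1 / (8 * η) < (n : ℝ)⁻¹ * ∑ i, log (1 + exp (-planarMargin a b A B s i)))
    (hm : ∀ i, 0 ≤ planarMargin a b A B s i) :
    (negSideLoss a b A B s)⁻¹ + η * γ ^ 2 / 4 ≤ (negSideLoss a b A B (s + 1))⁻¹ := by
  have hη := h.η_pos
  have hn := h.cast_pos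
  have hγ := h.γ_pos
  have hS := h.negSideLoss_ge hs hB hF
  set S := negSideLoss a b A B s with hSdef
  set c := η * γ ^ 2 / 4 with hc
  have hS0 : 0 < S := lt_of_lt_of_le (by positivity) hS
  have hc0 : 0 < c := by positivity
  have hdecay : ∀ i, b i < 0 → exp (-planarMargin a b A B (s + 1) i) ≤
      exp (-(c * S)) * exp (-planarMargin a b A B s i) := by
    intro i hb
    have := h.margin_succ_ge hs hB hF hm hb
    rw [← hSdef, ← hc] at this
    rw [← exp_add]
    exact exp_le_exp.2 (by linarith)
  have hle : negSideLoss a b A B (s + 1) ≤ exp (-(c * S)) * S := by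
    generalize exp (-(c * S)) = E at hdecay ⊢
    rw [hSdef]
    unfold negSideLoss
    rw [mul_left_comm]
    refine mul_le_mul_of_nonneg_left ?_ (by positivity)
    rw [mul_sum]
    refine sum_le_sum fun i _ => ?_
    split_ifs with hb
    · exact hdecay i hb
    · simp
  have hexp : exp (-(c * S)) ≤ (1 + c * S)⁻¹ := by
    rw [exp_neg]
    exact inv_anti₀ (by positivity) (by linarith [add_one_le_exp (c * S)])
  calc S⁻¹ + c = ((1 + c * S)⁻¹ * S)⁻¹ := by field_simp
    _ ≤ _ := inv_anti₀ hpos (hle.trans (by gcongr))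

/-- The loss exceeds the threshold for at most `64/γ²` correctly classified steps on a stretch
without sign change. -/
lemma classified_stretch_le (h : PlanarDescent n a b γ η A B) {r k : ℕ} (hr : 1 ≤ r)
    (hpos : ∀ i ≤ k, 0 < B (r + i))
    (hF : ∀ i ≤ k,
      1 / (8 * η) < (n : ℝ)⁻¹ * ∑ j, log (1 + exp (-planarMargin a b A B (r + i) j)))
    (hm : ∀ j, 0 ≤ planarMargin a b A B r j) : (k : ℝ) ≤ 64 / γ ^ 2 := by
  have hη := h.η_pos
  have hγ := h.γ_pos
  have hS : ∀ i ≤ k, 1 / (16 * η) ≤ negSideLoss a b A B (r + i) := fun i hi =>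
    h.negSideLoss_ge (by omega) (hpos i hi) (hF i hi)
  have hS0 : ∀ i ≤ k, 0 < negSideLoss a b A B (r + i) := fun i hi =>
    lt_of_lt_of_le (by positivity) (hS i hi)
  have key : ∀ i ≤ k, (∀ j, 0 ≤ planarMargin a b A B (r + i) j) ∧
      i * (η * γ ^ 2 / 4) ≤ (negSideLoss a b A B (r + i))⁻¹ := by
    intro i
    induction i with
    | zero => exact fun h0 => ⟨hm, by simpa using (hS0 0 h0).le⟩
    | succ i ih =>
      intro hi
      obtain ⟨h1, h2⟩ := ih (by omega)
      have hi' : i ≤ k := by omega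
      refine ⟨fun j => ?_, ?_⟩
      · rcases lt_or_ge (b j) 0 with hb | hb
        · have := h.margin_succ_ge (by omega) (hpos i hi') (hF i hi') h1 hb
          have h3 := hS0 i hi'
          have : 0 ≤ η * γ ^ 2 / 4 * negSideLoss a b A B (r + i) := by positivity
          rw [← add_assoc]
          linarith [h1 j]
        · have := h.sq_div_two_le (s := r + (i + 1)) (by omega) j
          have : 0 ≤ η * γ ^ 2 / 2 := by positivity
          have := mul_nonneg (hpos (i + 1) hi).le hb
          unfold planarMargin
          linarith
      · have := h.inv_negSideLoss_succ_ge (by omega) (hpos i hi') (hS0 (i + 1) hi) (hF i hi') h1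
        rw [← add_assoc]
        push_cast
        linarith
  have h1 := (key k le_rfl).2
  have h2 := inv_anti₀ (by positivity) (hS k le_rfl)
  rw [one_div, inv_inv] at h2
  rw [le_div_iff₀ (by positivity)]
  have : η * (k * γ ^ 2) ≤ η * 64 := by linarith
  exact le_of_mul_le_mul_left this hη

/-- A stretch with positive second coordinate and loss above the threshold is short. -/
lemma stretch_lt (h : PlanarDescent n a b γ η A B) {t K : ℕ}
    (hpos : ∀ i ≤ K, 0 < B (t + 1 + i))
    (hF : ∀ s ≤ t + 1 + K,
      1 / (8 * η) < (n : ℝ)⁻¹ * ∑ j, log (1 + exp (-planarMargin a b A B s j))) :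
    (K : ℝ) + 1 < 4 * n / γ + 96 / γ ^ 2 := by
  have hγ := h.γ_pos
  have hn := h.cast_pos
  obtain ⟨r, hrt, hr, hrpos⟩ : ∃ r ≤ t, B r ≤ 0 ∧ ∀ s, r < s → s ≤ t → 0 < B s := by
    classical
    have h0 : B 0 ≤ 0 := h.B_zero.le
    refine ⟨Nat.findGreatest (fun s => B s ≤ 0) t, Nat.findGreatest_le t,
      Nat.findGreatest_spec (P := fun s => B s ≤ 0) (Nat.zero_le t) h0, fun s hs hst => ?_⟩
    exact not_le.1 (Nat.findGreatest_is_greatest hs hst)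
  obtain ⟨L, hL⟩ : ∃ L, t + 1 + K = r + 1 + L := ⟨t + K - r, by omega⟩
  have hKL : (K : ℝ) ≤ L := by exact_mod_cast (by omega : K ≤ L)
  have hposL : ∀ i ≤ L, 0 < B (r + 1 + i) := by
    intro i hi
    rcases le_or_gt (r + 1 + i) t with hle | hgt
    · exact hrpos _ (by omega) hle
    · obtain ⟨m, hm⟩ : ∃ m, r + 1 + i = t + 1 + m := ⟨r + i - t, by omega⟩
      rw [hm]
      exact hpos m (by omega)
  have hγ2 : 1 ≤ 1 / γ ^ 2 := by
    rw [le_div_iff₀ (by positivity)]; linarith [h.γ_sq_le_one]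
  have e64 : 64 / γ ^ 2 = 64 * (1 / γ ^ 2) := by ring
  have e96 : 96 / γ ^ 2 = 96 * (1 / γ ^ 2) := by ring
  by_cases hall : ∀ i < L, ∃ j, planarMargin a b A B (r + 1 + i) j < 0
  · have := h.misclassified_stretch_lt hr hposL hall
    linarith
  · classical
    push Not at hall
    set m := Nat.find hall with hmdef
    obtain ⟨hmL, hmm⟩ := Nat.find_spec hall
    rw [← hmdef] at hmL hmm
    have h1 := h.misclassified_stretch_lt (k := m) hr (fun i hi => hposL i (by omega))
      (fun i hi => by
        have := Nat.find_min hall hi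
        push Not at this
        exact this (by omega))
    have h2 := h.classified_stretch_le (r := r + 1 + m) (k := L - m) (by omega)
      (fun i hi => by rw [add_assoc]; exact hposL _ (by omega))
      (fun i hi => hF _ (by omega)) hmm
    rw [Nat.cast_sub hmL.le] at h2
    linarith

end PlanarDescent

lemma inner_eq_of_orthonormal_pair {u v : EuclideanSpace ℝ (Fin 2)} (hu : ‖u‖ = 1)
    (hv : ‖v‖ = 1) (hvu : ⟪v, u⟫_ℝ = 0) (w y : EuclideanSpace ℝ (Fin 2)) :
    ⟪w, y⟫_ℝ = ⟪w, u⟫_ℝ * ⟪u, y⟫_ℝ + ⟪w, v⟫_ℝ * ⟪v, y⟫_ℝ := by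
  have huv : ⟪u, v⟫_ℝ = 0 := by rw [real_inner_comm, hvu]
  have ho : Orthonormal ℝ ![u, v] := by
    refine ⟨fun i => by fin_cases i <;> simp [hu, hv], fun i j hij => ?_⟩
    fin_cases i <;> fin_cases j <;> simp_all
  obtain ⟨e, he⟩ := Orthonormal.exists_orthonormalBasis_extension_of_card_eq
    (𝕜 := ℝ) (E := EuclideanSpace ℝ (Fin 2)) (ι := Fin 2) (by simp) (v := ![u, v])
    (s := Set.univ) (ho.comp _ Subtype.val_injective)
  have := e.sum_inner_mul_inner w y
  rw [Fin.sum_univ_two, he 0 (Set.mem_univ _), he 1 (Set.mem_univ _)] at this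
  simpa using this.symm

theorem stmt_9 (n : ℕ) (hn : 0 < n) (x : Fin n → EuclideanSpace ℝ (Fin 2))
    (hx : ∀ i, ‖x i‖ ≤ 1) (γ : ℝ) (hγ0 : 0 < γ) (hγ1 : γ < 1)
    (hmm : isMaxMargin n x γ)
    (wst : EuclideanSpace ℝ (Fin 2)) (hws : ‖wst‖ = 1) (hsep : ∀ i, γ ≤ ⟪wst, x i⟫_ℝ)
    (vst : EuclideanSpace ℝ (Fin 2)) (hvs : ‖vst‖ = 1) (hvw : ⟪vst, wst⟫_ℝ = 0)
    (η : ℝ) (hη : max (n : ℝ) (32 / γ ^ 2 * Real.log (256 / γ ^ 2)) ≤ η)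
    (t : ℕ) (ht : ∀ s : ℕ, s ≤ t → 1 / (8 * η) < logisticLoss n x (gdIter n x η s)) :
    ∃ s : ℕ, t < s ∧ (s : ℝ) ≤ (t : ℝ) + 1 + 4 * n / γ + 96 / γ ^ 2 ∧
      (IsLeast {r : ℕ | logisticLoss n x (gdIter n x η r) ≤ 1 / (8 * η)} s ∨
        oscillationAt n x γ η wst vst s) := by
  have hnη : (n : ℝ) ≤ η := (le_max_left _ _).trans hη
  have hη0 : 0 ≤ η := n.cast_nonneg.trans hnη
  have hdecomp : ∀ s i, ⟪gdIter n x η s, x i⟫_ℝ = planarMargin (fun i => ⟪wst, x i⟫_ℝ)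
      (fun i => ⟪vst, x i⟫_ℝ) (fun s => ⟪gdIter n x η s, wst⟫_ℝ)
      (fun s => ⟪gdIter n x η s, vst⟫_ℝ) s i := fun s i =>
    inner_eq_of_orthonormal_pair hws hvs hvw _ _
  have hstep : ∀ s u, ⟪gdIter n x η (s + 1), u⟫_ℝ = ⟪gdIter n x η s, u⟫_ℝ +
      η / n * ∑ i, (Real.exp ⟪gdIter n x η s, x i⟫_ℝ + 1)⁻¹ * ⟪u, x i⟫_ℝ := by
    intro s u
    rw [gdIter, inner_add_left, real_inner_smul_left, sum_inner]
    refine congrArg (fun c => _ + η / n * c) (Finset.sum_congr rfl fun i _ => ?_)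
    rw [real_inner_smul_left, real_inner_comm u]
  have h : PlanarDescent n (fun i => ⟪wst, x i⟫_ℝ) (fun i => ⟪vst, x i⟫_ℝ) γ η
      (fun s => ⟪gdIter n x η s, wst⟫_ℝ) (fun s => ⟪gdIter n x η s, vst⟫_ℝ) :=
    { n_pos := hn
      n_le := hnη
      γ_pos := hγ0
      noise := mul_exp_neg_le_of_large_step hγ0 hη0 ((le_max_right _ _).trans hη)
      sep := hsep
      norm_le := fun i => by
        have h1 := inner_eq_of_orthonormal_pair hws hvs hvw (x i) (x i)
        rw [real_inner_self_eq_norm_sq, real_inner_comm wst, real_inner_comm vst] at h1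
        have h2 : ‖x i‖ ^ 2 ≤ 1 := pow_le_one₀ (norm_nonneg _) (hx i)
        linarith
      A_zero := by simp [gdIter]
      B_zero := by simp [gdIter]
      A_succ := fun s => by simp only [hstep s wst, hdecomp]
      B_succ := fun s => by simp only [hstep s vst, hdecomp] }
  have hγ2 : 0 < 96 / γ ^ 2 := by positivity
  have hnγ : 0 ≤ 4 * n / γ := by positivity
  set K := ⌊4 * n / γ + 96 / γ ^ 2⌋₊ with hK
  have hKle : (K : ℝ) ≤ 4 * n / γ + 96 / γ ^ 2 := Nat.floor_le (by positivity)
  have hKlt : 4 * n / γ + 96 / γ ^ 2 < K + 1 := Nat.lt_floor_add_one _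
  have hbound : ∀ s, s ≤ t + 1 + K → (s : ℝ) ≤ t + 1 + 4 * n / γ + 96 / γ ^ 2 := by
    intro s hs
    have : (s : ℝ) ≤ t + 1 + K := by exact_mod_cast hs
    linarith
  by_contra hcon
  push Not at hcon
  have hF : ∀ s ≤ t + 1 + K, 1 / (8 * η) < logisticLoss n x (gdIter n x η s) := by
    classical
    by_contra hex
    push Not at hex
    obtain ⟨s, hs, hFs⟩ := hex
    have hex' : ∃ r, logisticLoss n x (gdIter n x η r) ≤ 1 / (8 * η) := ⟨s, hFs⟩
    have hle : Nat.find hex' ≤ s := Nat.find_min' hex' hFs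
    have hgt : t < Nat.find hex' := by
      by_contra hnot
      exact absurd (Nat.find_spec hex') (not_le.2 (ht _ (not_lt.1 hnot)))
    exact (hcon _ hgt (hbound _ (hle.trans hs))).1
      ⟨Nat.find_spec hex', fun r hr => Nat.find_min' hex' hr⟩
  have hF' : ∀ s ≤ t + 1 + K, 1 / (8 * η) < (n : ℝ)⁻¹ * ∑ i, Real.log (1 + Real.exp
      (-planarMargin (fun i => ⟪wst, x i⟫_ℝ) (fun i => ⟪vst, x i⟫_ℝ)
        (fun s => ⟪gdIter n x η s, wst⟫_ℝ) (fun s => ⟪gdIter n x η s, vst⟫_ℝ) s i)) := by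
    intro s hs
    have := hF s hs
    simpa only [logisticLoss, hdecomp] using this
  have hne : ∀ i ≤ K, ⟪gdIter n x η (t + 1 + i), vst⟫_ℝ ≠ 0 := fun i hi h0 =>
    absurd (hF' (t + 1 + i) (by omega)) (not_lt.2 (h.loss_le_of_B_eq_zero (by omega) h0))
  have hsame : ∀ i < K, 0 < ⟪gdIter n x η (t + 1 + (i + 1)), vst⟫_ℝ *
      ⟪gdIter n x η (t + 1 + i), vst⟫_ℝ := by
    intro i hi
    refine lt_of_le_of_ne ?_ (mul_ne_zero (hne _ (by omega)) (hne _ (by omega))).symm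
    by_contra hneg
    exact (hcon (t + 1 + i) (by omega) (hbound _ (by omega))).2
      ⟨h.lambdaThresh_le (by omega), hF _ (by omega), hF _ (by omega), not_le.1 hneg⟩
  rcases lt_or_gt_of_ne (hne 0 (Nat.zero_le _)) with h0 | h0
  · have hneg : ∀ i ≤ K, ⟪gdIter n x η (t + 1 + i), vst⟫_ℝ < 0 := by
      intro i
      induction i with
      | zero => exact fun _ => h0
      | succ i ih => exact fun hi => neg_of_mul_pos_left (hsame i hi) (ih (by omega)).le
    have := h.reflect.stretch_lt (t := t) (K := K) (fun i hi => neg_pos.2 (hneg i hi))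
      (fun s hs => by simpa [planarMargin] using hF' s hs)
    linarith
  · have hpos : ∀ i ≤ K, 0 < ⟪gdIter n x η (t + 1 + i), vst⟫_ℝ := by
      intro i
      induction i with
      | zero => exact fun _ => h0
      | succ i ih => exact fun hi => pos_of_mul_pos_left (hsame i hi) (ih (by omega)).le
    have := h.stretch_lt (t := t) (K := K) hpos hF'
    linarith
end

section
/- Suppose η ≥ η₀ = max(n, (32/γ²)·log(256/γ²)). For any t, if there exists an iteration t_k > t at which an oscillation happens, then ŵ_{t+1} ≥ (1 + γ²/2)·ŵ_t. -/
open scoped InnerProductSpace BigOperators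
open Finset

section PlanarDynamics

variable {n : ℕ}

/-- Derivative weight of the logistic loss at the point with coordinates `(a i, b i)`, for the
parameter with coordinates `(p, q)`. -/
noncomputable def sigWeight (a b : Fin n → ℝ) (p q : ℝ) (i : Fin n) : ℝ :=
  (Real.exp (a i * p + b i * q) + 1)⁻¹

/-- The gradient descent increment in the direction `c`. -/
noncomputable def gdStep (η : ℝ) (a b : Fin n → ℝ) (p q : ℝ) (c : Fin n → ℝ) : ℝ :=
  η / n * ∑ i, sigWeight a b p q i * c i

/-- The parameter `(p, q)` has `q ≥ 0`, and the points with `b i < 0` carry little gradient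
weight compared with the margin `γ * p`. -/
def SmallOppositeWeight (γ η : ℝ) (a b : Fin n → ℝ) (p q : ℝ) : Prop :=
  0 ≤ q ∧ gdStep η a b p q (fun i => if b i < 0 then 1 else 0) ≤ γ * p / 2

lemma sigWeight_pos (a b : Fin n → ℝ) (p q : ℝ) (i : Fin n) : 0 < sigWeight a b p q i := by
  unfold sigWeight; positivity

lemma gdStep_le_gdStep {η : ℝ} (hη : 0 ≤ η) {a b : Fin n → ℝ} {p q p' q' : ℝ} {c d : Fin n → ℝ}
    (h : ∀ i, sigWeight a b p q i * c i ≤ sigWeight a b p' q' i * d i) :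
    gdStep η a b p q c ≤ gdStep η a b p' q' d :=
  mul_le_mul_of_nonneg_left (Finset.sum_le_sum fun i _ => h i) (by positivity)

lemma gdStep_mono {η : ℝ} (hη : 0 ≤ η) (a b : Fin n → ℝ) (p q : ℝ) {c d : Fin n → ℝ}
    (h : ∀ i, c i ≤ d i) : gdStep η a b p q c ≤ gdStep η a b p q d :=
  gdStep_le_gdStep hη fun i => mul_le_mul_of_nonneg_left (h i) (sigWeight_pos a b p q i).le

lemma gdStep_const_mul (η : ℝ) (a b : Fin n → ℝ) (p q r : ℝ) (c : Fin n → ℝ) :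
    gdStep η a b p q (fun i => r * c i) = r * gdStep η a b p q c := by
  unfold gdStep
  rw [Finset.mul_sum, Finset.mul_sum, Finset.mul_sum]
  exact Finset.sum_congr rfl fun i _ => by ring

lemma gdStep_add (η : ℝ) (a b : Fin n → ℝ) (p q : ℝ) (c d : Fin n → ℝ) :
    gdStep η a b p q (fun i => c i + d i) = gdStep η a b p q c + gdStep η a b p q d := by
  unfold gdStep
  rw [← mul_add, ← Finset.sum_add_distrib]
  simp only [mul_add]

lemma gdStep_nonneg {η : ℝ} (hη : 0 ≤ η) (a b : Fin n → ℝ) (p q : ℝ) {c : Fin n → ℝ}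
    (h : ∀ i, 0 ≤ c i) : 0 ≤ gdStep η a b p q c := by
  have h0 := gdStep_mono hη a b p q (c := fun _ => 0) h
  simpa [gdStep] using h0

lemma average_le {K : ℝ} (hn : 0 < n) {f : Fin n → ℝ} (h : ∀ i, f i ≤ K) :
    (n : ℝ)⁻¹ * ∑ i, f i ≤ K := by
  have hs : ∑ i, f i ≤ n * K := by
    simpa using Finset.sum_le_sum fun i (_ : i ∈ Finset.univ) => h i
  rw [inv_mul_le_iff₀ (by exact_mod_cast hn)]
  exact hs

lemma gdStep_le_of_forall_le (hn : 0 < n) {η K : ℝ} (hη : 0 ≤ η) (a b : Fin n → ℝ) (p q : ℝ)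
    {c : Fin n → ℝ} (h : ∀ i, sigWeight a b p q i * c i ≤ K) :
    gdStep η a b p q c ≤ η * K := by
  unfold gdStep
  rw [div_eq_mul_inv, mul_assoc]
  exact mul_le_mul_of_nonneg_left (average_le hn h) hη

lemma sigWeight_le_exp {a b : Fin n → ℝ} {p q m : ℝ} {i : Fin n} (h : m ≤ a i * p + b i * q) :
    sigWeight a b p q i ≤ Real.exp (-m) := by
  unfold sigWeight
  rw [Real.exp_neg]
  refine inv_anti₀ (Real.exp_pos _) ?_
  linarith [Real.exp_le_exp.2 h]

/-- After one step, the inner product with the point `j`. -/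
lemma margin_step (η : ℝ) (a b : Fin n → ℝ) (p q : ℝ) (j : Fin n) :
    a j * (p + gdStep η a b p q a) + b j * (q + gdStep η a b p q b) =
      a j * p + b j * q + gdStep η a b p q (fun i => a j * a i + b j * b i) := by
  rw [gdStep_add, gdStep_const_mul, gdStep_const_mul]
  ring

/-- If the second coordinate changes sign, then all points are classified with a large margin. -/
lemma margin_ge_of_flip {γ η : ℝ} (hγ : 0 < γ) (hη : 0 < η) {a b : Fin n → ℝ}
    (ha : ∀ i, γ ≤ a i) (hab : ∀ i j, -1 ≤ a i * a j + b i * b j) {p q : ℝ} (hp : 0 ≤ p)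
    (h : SmallOppositeWeight γ η a b p q) (hflip : q + gdStep η a b p q b < 0) (j : Fin n) :
    γ * p / 2 ≤ a j * (p + gdStep η a b p q a) + b j * (q + gdStep η a b p q b) := by
  obtain ⟨hq, hw⟩ := h
  rcases lt_or_ge (b j) 0 with hb | hb
  · have h1 : 0 ≤ gdStep η a b p q a := gdStep_nonneg hη.le _ _ _ _ fun i => hγ.le.trans (ha i)
    nlinarith [mul_pos_of_neg_of_neg hb hflip, mul_le_mul_of_nonneg_right (ha j) hp,
      mul_nonneg (hγ.le.trans (ha j)) h1, mul_nonneg hγ.le hp]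
  · rw [margin_step]
    have h2 : gdStep η a b p q (fun i => (-1) * (if b i < 0 then 1 else 0)) ≤
        gdStep η a b p q (fun i => a j * a i + b j * b i) := by
      refine gdStep_mono hη.le _ _ _ _ fun i => ?_
      split_ifs with hi
      · simpa using hab j i
      · push Not at hi
        have := mul_nonneg (hγ.le.trans (ha j)) (hγ.le.trans (ha i))
        have := mul_nonneg hb hi
        linarith
    rw [gdStep_const_mul] at h2
    nlinarith [mul_le_mul_of_nonneg_right (ha j) hp, mul_nonneg hb hq]

lemma sigWeight_le_three_mul {a b : Fin n → ℝ} {p q p' q' : ℝ} {i : Fin n}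
    (h : a i * p + b i * q - 1 ≤ a i * p' + b i * q') :
    sigWeight a b p' q' i ≤ 3 * sigWeight a b p q i := by
  unfold sigWeight
  have h1 : Real.exp (a i * p + b i * q) ≤ 3 * Real.exp (a i * p' + b i * q') := by
    have e1 := Real.exp_one_lt_d9
    calc Real.exp (a i * p + b i * q) ≤ Real.exp (1 + (a i * p' + b i * q')) :=
          Real.exp_le_exp.2 (by linarith)
      _ = Real.exp 1 * Real.exp (a i * p' + b i * q') := Real.exp_add _ _
      _ ≤ _ := by gcongr; linarith
  rw [← div_eq_mul_inv, inv_eq_one_div, div_le_div_iff₀ (by positivity) (by positivity)]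
  linarith

/-- If the second coordinate does not change sign, the weight of the points with `b i < 0`
stays small. -/
lemma smallOppositeWeight_of_not_flip (hn : 0 < n) {γ η : ℝ} (hγ : 0 < γ) (hη : 0 < η)
    {a b : Fin n → ℝ} (ha : ∀ i, γ ≤ a i) (hab : ∀ i j, -1 ≤ a i * a j + b i * b j)
    (hb : ∀ i j, -1 ≤ b i * b j) {p q : ℝ} (hp : 6 ≤ γ * p) (hsmall : η * Real.exp (-(γ * p)) ≤ γ ^ 2)
    (h : SmallOppositeWeight γ η a b p q) (hflip : 0 ≤ q + gdStep η a b p q b) :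
    SmallOppositeWeight γ η a b (p + gdStep η a b p q a) (q + gdStep η a b p q b) := by
  obtain ⟨hq, hw⟩ := h
  refine ⟨hflip, ?_⟩
  have hp0 : 0 ≤ p := by
    by_contra hc
    push Not at hc
    nlinarith
  have h1 : 0 ≤ gdStep η a b p q a := gdStep_nonneg hη.le _ _ _ _ fun i => hγ.le.trans (ha i)
  have h1' := mul_nonneg hγ.le h1
  rcases le_or_gt (gdStep η a b p q fun _ => 1) 1 with hG | hG
  · have hW : gdStep η a b p q (fun i => if b i < 0 then 1 else 0) ≤ 1 := by
      refine (gdStep_mono hη.le _ _ _ _ fun i => ?_).trans hG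
      split_ifs <;> norm_num
    have h3 : gdStep η a b (p + gdStep η a b p q a) (q + gdStep η a b p q b)
        (fun i => if b i < 0 then 1 else 0) ≤
        3 * gdStep η a b p q (fun i => if b i < 0 then 1 else 0) := by
      rw [← gdStep_const_mul]
      refine gdStep_le_gdStep hη.le fun j => ?_
      split_ifs with hj
      · rw [mul_one, mul_one, mul_comm]
        refine sigWeight_le_three_mul ?_
        rw [margin_step]
        have := gdStep_mono hη.le a b p q (c := fun _ => (-1) * 1)
          (d := fun i => a j * a i + b j * b i) fun i => by simpa using hab j i
        rw [gdStep_const_mul η a b p q (-1) fun _ => 1] at this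
        linarith
      · simp
    linarith
  · refine le_trans ?_ (hw.trans (by linarith))
    refine gdStep_le_gdStep hη.le fun j => ?_
    split_ifs with hj
    · rw [mul_one, mul_one]
      unfold sigWeight
      refine inv_anti₀ (by positivity) ?_
      rw [add_le_add_iff_right, Real.exp_le_exp, margin_step, le_add_iff_nonneg_right]
      have h4 : gdStep η a b p q (fun i => γ ^ 2 * 1 + (-1) * (if b i < 0 then 0 else 1)) ≤
          gdStep η a b p q (fun i => a j * a i + b j * b i) := by
        refine gdStep_mono hη.le _ _ _ _ fun i => ?_
        have haa : γ ^ 2 ≤ a j * a i := by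
          rw [sq]; exact mul_le_mul (ha j) (ha i) hγ.le (hγ.le.trans (ha j))
        split_ifs with hi
        · linarith [mul_pos_of_neg_of_neg hj hi]
        · linarith [hb j i]
      rw [gdStep_add η a b p q (fun _ => γ ^ 2 * 1), gdStep_const_mul η a b p q _ fun _ => 1,
        gdStep_const_mul] at h4
      have h5 : gdStep η a b p q (fun i => if b i < 0 then 0 else 1) ≤
          η * Real.exp (-(γ * p)) := by
        refine gdStep_le_of_forall_le hn hη.le _ _ _ _ fun i => ?_
        split_ifs with hi
        · simpa using (Real.exp_pos _).le
        · push Not at hi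
          rw [mul_one]
          refine sigWeight_le_exp ?_
          nlinarith [mul_nonneg hi hq, mul_le_mul_of_nonneg_right (ha i) hp0]
      nlinarith [mul_le_mul_of_nonneg_left hG.le (sq_nonneg γ)]
    · simp

end PlanarDynamics

/-- The two numerical consequences of a large step size. -/
lemma exp_large_step {γ η : ℝ} (hγ0 : 0 < γ) (hγ1 : γ < 1)
    (hη : 32 / γ ^ 2 * Real.log (256 / γ ^ 2) ≤ η) :
    12 ≤ γ ^ 2 * η / 2 ∧ 8 * η ≤ Real.exp (γ ^ 2 * η / 4) := by
  set L := Real.log (256 / γ ^ 2) with hL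
  have hg : 0 < γ ^ 2 := by positivity
  have hg1 : γ ^ 2 < 1 := by nlinarith
  have hL1 : 1 ≤ L := by
    rw [hL, Real.le_log_iff_exp_le (by positivity), le_div_iff₀ hg]
    nlinarith [Real.exp_one_lt_d9, Real.exp_pos 1]
  have h32 : 32 * L ≤ γ ^ 2 * η := by
    have := mul_le_mul_of_nonneg_left hη hg.le
    calc 32 * L = γ ^ 2 * (32 / γ ^ 2 * L) := by field_simp
      _ ≤ _ := this
  refine ⟨by linarith, ?_⟩
  set y := γ ^ 2 * η / 4 with hy
  have hy0 : 0 ≤ y := by linarith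
  have he : 256 / γ ^ 2 ≤ Real.exp (y / 8) := by
    rw [← Real.log_le_iff_le_exp (by positivity)]
    linarith
  have hy8 : y / 8 ≤ Real.exp (y / 8) := by linarith [Real.add_one_le_exp (y / 8)]
  calc 8 * η = y / 8 * (256 / γ ^ 2) := by rw [hy]; field_simp; ring
    _ ≤ Real.exp (y / 8) * Real.exp (y / 8) := by gcongr
    _ = Real.exp (y / 8 + y / 8) := (Real.exp_add _ _).symm
    _ ≤ Real.exp y := Real.exp_le_exp.2 (by linarith)

lemma inner_eq_add_of_orthonormal {u v : EuclideanSpace ℝ (Fin 2)} (hu : ‖u‖ = 1) (hv : ‖v‖ = 1)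
    (hvu : ⟪v, u⟫_ℝ = 0) (y z : EuclideanSpace ℝ (Fin 2)) :
    ⟪y, z⟫_ℝ = ⟪y, u⟫_ℝ * ⟪z, u⟫_ℝ + ⟪y, v⟫_ℝ * ⟪z, v⟫_ℝ := by
  have ho : Orthonormal ℝ ![u, v] := by
    rw [orthonormal_iff_ite]
    intro i j
    fin_cases i <;> fin_cases j <;>
      simp [hu, hv, hvu, real_inner_comm v u]
  let B := (basisOfOrthonormalOfCardEqFinrank ho (by simp)).toOrthonormalBasis (by simpa using ho)
  have h := B.sum_inner_mul_inner y z
  rw [← h]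
  simp [B, real_inner_comm z]

section Iterates

variable {n : ℕ} {x : Fin n → EuclideanSpace ℝ (Fin 2)} {γ η : ℝ}
  {wst vst : EuclideanSpace ℝ (Fin 2)}

lemma inner_gdIter_succ (hws : ‖wst‖ = 1) (hvs : ‖vst‖ = 1) (hvw : ⟪vst, wst⟫_ℝ = 0)
    (u : EuclideanSpace ℝ (Fin 2)) (t : ℕ) :
    ⟪gdIter n x η (t + 1), u⟫_ℝ = ⟪gdIter n x η t, u⟫_ℝ +
      gdStep η (fun i => ⟪x i, wst⟫_ℝ) (fun i => ⟪x i, vst⟫_ℝ) ⟪gdIter n x η t, wst⟫_ℝ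
        ⟪gdIter n x η t, vst⟫_ℝ (fun i => ⟪x i, u⟫_ℝ) := by
  rw [gdIter, inner_add_left, real_inner_smul_left, sum_inner]
  simp only [real_inner_smul_left]
  unfold gdStep sigWeight
  congr 2
  refine Finset.sum_congr rfl fun i _ => ?_
  rw [real_inner_comm (x i) (gdIter n x η t), inner_eq_add_of_orthonormal hws hvs hvw (x i)]

lemma logisticLoss_le (hn : 0 < n) {w : EuclideanSpace ℝ (Fin 2)} {m : ℝ}
    (h : ∀ i, m ≤ ⟪w, x i⟫_ℝ) : logisticLoss n x w ≤ Real.exp (-m) := by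
  refine average_le hn fun i => ?_
  have h1 := Real.log_le_sub_one_of_pos (x := 1 + Real.exp (-⟪w, x i⟫_ℝ)) (by positivity)
  have h2 : Real.exp (-⟪w, x i⟫_ℝ) ≤ Real.exp (-m) := Real.exp_le_exp.2 (neg_le_neg (h i))
  linarith

lemma inner_gdIter_le_succ (hη : 0 < η) (hws : ‖wst‖ = 1)
    (hsep : ∀ i, γ ≤ ⟪wst, x i⟫_ℝ) (hvs : ‖vst‖ = 1) (hvw : ⟪vst, wst⟫_ℝ = 0) (t : ℕ) :
    ⟪gdIter n x η t, wst⟫_ℝ + γ * gdStep η (fun i => ⟪x i, wst⟫_ℝ) (fun i => ⟪x i, vst⟫_ℝ)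
      ⟪gdIter n x η t, wst⟫_ℝ ⟪gdIter n x η t, vst⟫_ℝ (fun _ => 1) ≤
      ⟪gdIter n x η (t + 1), wst⟫_ℝ := by
  rw [inner_gdIter_succ hws hvs hvw, ← gdStep_const_mul]
  gcongr
  refine gdStep_mono hη.le _ _ _ _ fun i => ?_
  rw [mul_one, real_inner_comm]
  exact hsep i

lemma inner_gdIter_ge (hn : 0 < n) (hγ : 0 < γ) (hη : 0 < η) (hws : ‖wst‖ = 1)
    (hsep : ∀ i, γ ≤ ⟪wst, x i⟫_ℝ) (hvs : ‖vst‖ = 1) (hvw : ⟪vst, wst⟫_ℝ = 0) (t : ℕ) :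
    γ * η / 2 ≤ ⟪gdIter n x η (t + 1), wst⟫_ℝ := by
  have hn' : (n : ℝ) ≠ 0 := by positivity
  induction t with
  | zero =>
    refine le_trans (le_of_eq ?_) (inner_gdIter_le_succ hη hws hsep hvs hvw 0)
    simp [gdIter, gdStep, sigWeight]
    field_simp
    norm_num
  | succ t ih =>
    refine ih.trans (le_trans ?_ (inner_gdIter_le_succ hη hws hsep hvs hvw (t + 1)))
    rw [le_add_iff_nonneg_right]
    exact mul_nonneg hγ.le (gdStep_nonneg hη.le _ _ _ _ fun _ => zero_le_one)

/-- `SmallOppositeWeight` for the `t`-th gradient descent iterate, in the coordinates given by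
`u` and `v`. -/
def SmallOppositeWeightAt (n : ℕ) (x : Fin n → EuclideanSpace ℝ (Fin 2)) (γ η : ℝ)
    (u v : EuclideanSpace ℝ (Fin 2)) (t : ℕ) : Prop :=
  SmallOppositeWeight γ η (fun i => ⟪x i, u⟫_ℝ) (fun i => ⟪x i, v⟫_ℝ)
    ⟪gdIter n x η t, u⟫_ℝ ⟪gdIter n x η t, v⟫_ℝ

lemma neg_one_le_inner_mul_inner {y z v : EuclideanSpace ℝ (Fin 2)} (hy : ‖y‖ ≤ 1) (hz : ‖z‖ ≤ 1)
    (hv : ‖v‖ = 1) : -1 ≤ ⟪y, v⟫_ℝ * ⟪z, v⟫_ℝ := by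
  have h1 : |⟪y, v⟫_ℝ| ≤ 1 := (abs_real_inner_le_norm y v).trans (by rwa [hv, mul_one])
  have h2 : |⟪z, v⟫_ℝ| ≤ 1 := (abs_real_inner_le_norm z v).trans (by rwa [hv, mul_one])
  have h3 : |⟪y, v⟫_ℝ * ⟪z, v⟫_ℝ| ≤ 1 := by
    rw [abs_mul]; exact mul_le_one₀ h1 (abs_nonneg _) h2
  exact (abs_le.1 h3).1

lemma neg_one_le_coords (hx : ∀ i, ‖x i‖ ≤ 1) (hws : ‖wst‖ = 1) (hvs : ‖vst‖ = 1)
    (hvw : ⟪vst, wst⟫_ℝ = 0) (i j : Fin n) :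
    -1 ≤ ⟪x i, wst⟫_ℝ * ⟪x j, wst⟫_ℝ + ⟪x i, vst⟫_ℝ * ⟪x j, vst⟫_ℝ := by
  rw [← inner_eq_add_of_orthonormal hws hvs hvw]
  have h1 := abs_real_inner_le_norm (x i) (x j)
  have h2 : ‖x i‖ * ‖x j‖ ≤ 1 := mul_le_one₀ (hx i) (norm_nonneg _) (hx j)
  exact (abs_le.1 (h1.trans h2)).1

/-- A sign change of the second coordinate produces large margins. -/
lemma margin_ge_of_flip_at (hx : ∀ i, ‖x i‖ ≤ 1) (hγ : 0 < γ) (hη : 0 < η) (hws : ‖wst‖ = 1)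
    (hsep : ∀ i, γ ≤ ⟪wst, x i⟫_ℝ) (hvs : ‖vst‖ = 1) (hvw : ⟪vst, wst⟫_ℝ = 0) {t : ℕ}
    (hp : 0 ≤ ⟪gdIter n x η t, wst⟫_ℝ) (h : SmallOppositeWeightAt n x γ η wst vst t)
    (hflip : ⟪gdIter n x η (t + 1), vst⟫_ℝ < 0) (j : Fin n) :
    γ * ⟪gdIter n x η t, wst⟫_ℝ / 2 ≤ ⟪gdIter n x η (t + 1), x j⟫_ℝ := by
  rw [inner_gdIter_succ hws hvs hvw vst] at hflip
  have := margin_ge_of_flip hγ hη (fun i => by rw [real_inner_comm]; exact hsep i)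
    (neg_one_le_coords hx hws hvs hvw) hp h hflip j
  rwa [← inner_gdIter_succ hws hvs hvw, ← inner_gdIter_succ hws hvs hvw,
    ← inner_eq_add_of_orthonormal hws hvs hvw, real_inner_comm (gdIter n x η (t + 1))] at this

/-- The smallness of the opposite weight persists along the iteration, up to the sign of `v`. -/
lemma smallOppositeWeightAt_succ (hn : 0 < n) (hx : ∀ i, ‖x i‖ ≤ 1) (hγ0 : 0 < γ) (hγ1 : γ < 1)
    (hη : 32 / γ ^ 2 * Real.log (256 / γ ^ 2) ≤ η) (hη0 : 0 < η) (hws : ‖wst‖ = 1)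
    (hsep : ∀ i, γ ≤ ⟪wst, x i⟫_ℝ) (hvs : ‖vst‖ = 1) (hvw : ⟪vst, wst⟫_ℝ = 0) {t : ℕ}
    (hp : γ * η / 2 ≤ ⟪gdIter n x η t, wst⟫_ℝ) (h : SmallOppositeWeightAt n x γ η wst vst t) :
    SmallOppositeWeightAt n x γ η wst vst (t + 1) ∨
      SmallOppositeWeightAt n x γ η wst (-vst) (t + 1) := by
  obtain ⟨h12, h8⟩ := exp_large_step hγ0 hγ1 hη
  have hm : γ ^ 2 * η / 2 ≤ γ * ⟪gdIter n x η t, wst⟫_ℝ := by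
    nlinarith [mul_le_mul_of_nonneg_left hp hγ0.le]
  have hexp : η * Real.exp (-(γ * ⟪gdIter n x η t, wst⟫_ℝ / 2)) ≤ 1 / 8 := by
    rw [Real.exp_neg, ← div_eq_mul_inv, div_le_iff₀ (Real.exp_pos _)]
    have : Real.exp (γ ^ 2 * η / 4) ≤ Real.exp (γ * ⟪gdIter n x η t, wst⟫_ℝ / 2) :=
      Real.exp_le_exp.2 (by linarith)
    linarith
  have hp0 : 0 ≤ ⟪gdIter n x η t, wst⟫_ℝ := le_trans (by positivity) hp
  rcases lt_or_ge ⟪gdIter n x η (t + 1), vst⟫_ℝ 0 with hf | hf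
  · right
    have hmar := margin_ge_of_flip_at hx hγ0 hη0 hws hsep hvs hvw hp0 h hf
    refine ⟨by rw [inner_neg_right]; linarith, ?_⟩
    have hmono := inner_gdIter_le_succ (n := n) hη0 hws hsep hvs hvw t
    have hG := mul_nonneg hγ0.le (gdStep_nonneg hη0.le (fun i => ⟪x i, wst⟫_ℝ)
      (fun i => ⟪x i, vst⟫_ℝ) ⟪gdIter n x η t, wst⟫_ℝ ⟪gdIter n x η t, vst⟫_ℝ
      fun _ => zero_le_one)
    have hle : γ * ⟪gdIter n x η t, wst⟫_ℝ ≤ γ * ⟪gdIter n x η (t + 1), wst⟫_ℝ :=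
      mul_le_mul_of_nonneg_left (by linarith) hγ0.le
    refine (gdStep_le_of_forall_le hn hη0.le _ _ _ _ (K := Real.exp
      (-(γ * ⟪gdIter n x η t, wst⟫_ℝ / 2))) fun i => ?_).trans (by linarith)
    split_ifs
    · rw [mul_one]
      refine sigWeight_le_exp ?_
      have := hmar i
      rw [real_inner_comm (x i), inner_eq_add_of_orthonormal hws hvs hvw (x i)] at this
      simpa [inner_neg_right] using this
    · rw [mul_zero]; positivity
  · left
    unfold SmallOppositeWeightAt
    rw [inner_gdIter_succ hws hvs hvw vst] at hf ⊢
    rw [inner_gdIter_succ hws hvs hvw wst]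
    refine smallOppositeWeight_of_not_flip hn hγ0 hη0
      (fun i => by rw [real_inner_comm]; exact hsep i) (neg_one_le_coords hx hws hvs hvw)
      (fun i j => neg_one_le_inner_mul_inner (hx i) (hx j) hvs) (by linarith) ?_ h hf
    set e := Real.exp (-(γ * ⟪gdIter n x η t, wst⟫_ℝ / 2)) with he
    have hee : Real.exp (-(γ * ⟪gdIter n x η t, wst⟫_ℝ)) = e * e := by
      rw [he, ← Real.exp_add]; congr 1; ring
    have he0 : 0 < e := Real.exp_pos _
    rw [hee]
    have hk : η * (η * (e * e)) ≤ η * γ ^ 2 := by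
      nlinarith [mul_le_mul hexp hexp (by positivity) (by norm_num)]
    exact le_of_mul_le_mul_left hk hη0

end Iterates

theorem stmt_10 (n : ℕ) (hn : 0 < n) (x : Fin n → EuclideanSpace ℝ (Fin 2))
    (hx : ∀ i, ‖x i‖ ≤ 1) (γ : ℝ) (hγ0 : 0 < γ) (hγ1 : γ < 1)
    (hmm : isMaxMargin n x γ)
    (wst : EuclideanSpace ℝ (Fin 2)) (hws : ‖wst‖ = 1) (hsep : ∀ i, γ ≤ ⟪wst, x i⟫_ℝ)
    (vst : EuclideanSpace ℝ (Fin 2)) (hvs : ‖vst‖ = 1) (hvw : ⟪vst, wst⟫_ℝ = 0)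
    (η : ℝ) (hη : max (n : ℝ) (32 / γ ^ 2 * Real.log (256 / γ ^ 2)) ≤ η)
    (t : ℕ) (hosc : ∃ tk : ℕ, t < tk ∧ oscillationAt n x γ η wst vst tk) :
    (1 + γ ^ 2 / 2) * ⟪gdIter n x η t, wst⟫_ℝ ≤ ⟪gdIter n x η (t + 1), wst⟫_ℝ := by
  obtain ⟨tk, htk, -, -, hF, hsign⟩ := hosc
  have hη' := (le_max_right _ _).trans hη
  have hη0 : 0 < η :=
    lt_of_lt_of_le (by exact_mod_cast hn) ((le_max_left _ _).trans hη)
  have hvs' : ‖-vst‖ = 1 := by rwa [norm_neg]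
  have hvw' : ⟪-vst, wst⟫_ℝ = 0 := by rw [inner_neg_left, hvw, neg_zero]
  have hmono := inner_gdIter_le_succ (n := n) hη0 hws hsep hvs hvw t
  rcases Nat.eq_zero_or_pos t with rfl | ht
  · have hG := mul_nonneg hγ0.le (gdStep_nonneg hη0.le (fun i => ⟪x i, wst⟫_ℝ)
      (fun i => ⟪x i, vst⟫_ℝ) ⟪gdIter n x η 0, wst⟫_ℝ ⟪gdIter n x η 0, vst⟫_ℝ
      fun _ => zero_le_one)
    have h0 : ⟪gdIter n x η 0, wst⟫_ℝ = 0 := by simp [gdIter]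
    rw [h0] at hmono hG ⊢
    linarith
  by_contra! hcon
  have hlow : ∀ s, t ≤ s → γ * η / 2 ≤ ⟪gdIter n x η s, wst⟫_ℝ := fun s hs => by
    obtain ⟨r, rfl⟩ : ∃ r, s = r + 1 := ⟨s - 1, by omega⟩
    exact inner_gdIter_ge hn hγ0 hη0 hws hsep hvs hvw r
  have hstart : ∀ v : EuclideanSpace ℝ (Fin 2), ‖v‖ = 1 → ⟪v, wst⟫_ℝ = 0 →
      0 ≤ ⟪gdIter n x η t, v⟫_ℝ → SmallOppositeWeightAt n x γ η wst v t := fun v hv hvw hq => by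
    refine ⟨hq, ?_⟩
    have hG := inner_gdIter_le_succ (n := n) hη0 hws hsep hv hvw t
    refine (gdStep_mono hη0.le _ _ _ _ (d := fun _ => 1) fun i => ?_).trans
      (le_of_mul_le_mul_left (a := γ) ?_ hγ0)
    · split_ifs <;> norm_num
    · linarith
  have hall : ∀ s, t ≤ s → SmallOppositeWeightAt n x γ η wst vst s ∨
      SmallOppositeWeightAt n x γ η wst (-vst) s := fun s hs => by
    induction s, hs using Nat.le_induction with
    | base =>
      rcases le_total 0 ⟪gdIter n x η t, vst⟫_ℝ with hq | hq
      · exact Or.inl (hstart vst hvs hvw hq)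
      · exact Or.inr (hstart (-vst) hvs' hvw' (by rw [inner_neg_right]; linarith))
    | succ s hs ih =>
      rcases ih with ih | ih
      · exact smallOppositeWeightAt_succ hn hx hγ0 hγ1 hη' hη0 hws hsep hvs hvw (hlow s hs) ih
      · simpa only [neg_neg] using
          (smallOppositeWeightAt_succ hn hx hγ0 hγ1 hη' hη0 hws hsep hvs' hvw' (hlow s hs) ih).symm
  have hp := hlow tk htk.le
  have hp0 : 0 ≤ ⟪gdIter n x η tk, wst⟫_ℝ := le_trans (by positivity) hp
  have hmar : ∀ j, γ * ⟪gdIter n x η tk, wst⟫_ℝ / 2 ≤ ⟪gdIter n x η (tk + 1), x j⟫_ℝ := by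
    rcases hall tk htk.le with h | h
    · refine margin_ge_of_flip_at hx hγ0 hη0 hws hsep hvs hvw hp0 h ?_
      by_contra! hc
      exact hsign.not_ge (mul_nonneg hc h.1)
    · refine margin_ge_of_flip_at hx hγ0 hη0 hws hsep hvs' hvw' hp0 h ?_
      by_contra! hc
      have := mul_nonneg hc h.1
      rw [inner_neg_right, inner_neg_right, neg_mul_neg] at this
      exact hsign.not_ge this
  refine hF.not_ge ((logisticLoss_le hn hmar).trans ?_)
  rw [Real.exp_neg, ← one_div]
  refine one_div_le_one_div_of_le (by positivity)
    ((exp_large_step hγ0 hγ1 hη').2.trans (Real.exp_le_exp.2 ?_))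
  nlinarith [mul_le_mul_of_nonneg_left hp hγ0.le]
end

section
/- Suppose η ≥ n and F(w_T) ≤ 1/(8η) for some iteration T. Then the loss decreases monotonically in the stable phase: F(w_{t+1}) ≤ F(w_t) for all t ≥ T, and moreover F(w_t) ≤ 8/(η·γ²·(t − T)) for all t > T. -/
open scoped InnerProductSpace BigOperators
open Finset

/-- Logistic loss `F(w) = (1/n) ∑ᵢ log(1 + exp(−⟨w, xᵢ⟩))`, in dimension `d`. -/
noncomputable def logisticLossD (d n : ℕ) (x : Fin n → EuclideanSpace ℝ (Fin d))
    (w : EuclideanSpace ℝ (Fin d)) : ℝ :=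
  (n : ℝ)⁻¹ * ∑ i, Real.log (1 + Real.exp (-⟪w, x i⟫_ℝ))

/-- Gradient potential `G(w) = (1/n) ∑ᵢ 1/(exp(⟨w, xᵢ⟩) + 1)`, in dimension `d`. -/
noncomputable def gradPotentialD (d n : ℕ) (x : Fin n → EuclideanSpace ℝ (Fin d))
    (w : EuclideanSpace ℝ (Fin d)) : ℝ :=
  (n : ℝ)⁻¹ * ∑ i, (Real.exp ⟪w, x i⟫_ℝ + 1)⁻¹

/-- `γ` is the maximum margin of the dataset `x`:
it is the greatest `m` such that some unit vector `w` satisfies `⟨w, xᵢ⟩ ≥ m` for all `i`. -/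
def isMaxMarginD (d n : ℕ) (x : Fin n → EuclideanSpace ℝ (Fin d)) (γ : ℝ) : Prop :=
  IsGreatest {m : ℝ | ∃ w : EuclideanSpace ℝ (Fin d), ‖w‖ = 1 ∧ ∀ i, m ≤ ⟪w, x i⟫_ℝ} γ

/-- Second-order upper bound for the scalar logistic loss along a bounded increment. -/
lemma log_one_add_exp_neg_add_le (z δ : ℝ) (hδ : |δ| ≤ 1) :
    Real.log (1 + Real.exp (-(z + δ))) ≤ Real.log (1 + Real.exp (-z))
      - (Real.exp z + 1)⁻¹ * δ + (Real.exp z + 1)⁻¹ * δ ^ 2 := by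
  have hz := Real.exp_pos z
  have hd := Real.exp_pos (-δ)
  have hquad : Real.exp (-δ) - 1 ≤ -δ + δ ^ 2 := by
    have h := Real.abs_exp_sub_one_sub_id_le (x := -δ) (by rwa [abs_neg])
    have := (abs_le.mp h).2
    nlinarith
  have hfactor : 1 + Real.exp (-(z + δ))
      = (1 + Real.exp (-z)) * ((Real.exp z + Real.exp (-δ)) / (Real.exp z + 1)) := by
    rw [neg_add, Real.exp_add, Real.exp_neg z]
    field_simp
  have hratio : 0 < (Real.exp z + Real.exp (-δ)) / (Real.exp z + 1) := by positivity
  rw [hfactor, Real.log_mul (by positivity) hratio.ne']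
  have hlog := Real.log_le_sub_one_of_pos hratio
  have heq : (Real.exp z + Real.exp (-δ)) / (Real.exp z + 1) - 1
      = (Real.exp z + 1)⁻¹ * (Real.exp (-δ) - 1) := by
    field_simp
    ring
  have hmul := mul_le_mul_of_nonneg_left hquad (by positivity : 0 ≤ (Real.exp z + 1)⁻¹)
  rw [heq] at hlog
  linarith

lemma inv_exp_add_one_le_log (z : ℝ) :
    (Real.exp z + 1)⁻¹ ≤ Real.log (1 + Real.exp (-z)) := by
  have hz := Real.exp_pos z
  have h := Real.one_sub_inv_le_log_of_pos (x := 1 + Real.exp (-z)) (by positivity)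
  have heq : 1 - (1 + Real.exp (-z))⁻¹ = (Real.exp z + 1)⁻¹ := by
    rw [Real.exp_neg]
    field_simp
    ring
  rwa [heq] at h

lemma log_le_two_mul_inv_exp_add_one (z : ℝ)
    (h : Real.log (1 + Real.exp (-z)) ≤ Real.log 2) :
    Real.log (1 + Real.exp (-z)) ≤ 2 * (Real.exp z + 1)⁻¹ := by
  have hz := Real.exp_pos z
  have hlog := Real.log_le_sub_one_of_pos (x := 1 + Real.exp (-z)) (by positivity)
  have ha : 1 + Real.exp (-z) ≤ 2 :=
    (Real.log_le_log_iff (by positivity) (by norm_num)).mp h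
  have hone : 1 ≤ Real.exp z := by
    rw [Real.one_le_exp_iff]
    have : Real.exp (-z) ≤ 1 := by linarith
    rw [Real.exp_le_one_iff] at this
    linarith
  refine hlog.trans ?_
  rw [Real.exp_neg, add_sub_cancel_left, ← div_eq_mul_inv, inv_eq_one_div,
    div_le_div_iff₀ hz (by positivity)]
  linarith

lemma logisticLossD_pos {d n : ℕ} (hn : 0 < n) (x : Fin n → EuclideanSpace ℝ (Fin d))
    (w : EuclideanSpace ℝ (Fin d)) : 0 < logisticLossD d n x w := by
  have : Nonempty (Fin n) := ⟨⟨0, hn⟩⟩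
  have hn' : (0 : ℝ) < n := by exact_mod_cast hn
  refine mul_pos (inv_pos.mpr hn') (Finset.sum_pos (fun i _ => ?_) Finset.univ_nonempty)
  exact Real.log_pos (by linarith [Real.exp_pos (-⟪w, x i⟫_ℝ)])

lemma gradPotentialD_nonneg {d n : ℕ} (x : Fin n → EuclideanSpace ℝ (Fin d))
    (w : EuclideanSpace ℝ (Fin d)) : 0 ≤ gradPotentialD d n x w := by
  unfold gradPotentialD
  positivity

lemma gradPotentialD_le_logisticLossD {d n : ℕ} (x : Fin n → EuclideanSpace ℝ (Fin d))
    (w : EuclideanSpace ℝ (Fin d)) : gradPotentialD d n x w ≤ logisticLossD d n x w := by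
  unfold gradPotentialD logisticLossD
  gcongr with i
  exact inv_exp_add_one_le_log _

lemma logisticLossD_le_two_mul_gradPotentialD {d n : ℕ} (hn : 0 < n)
    (x : Fin n → EuclideanSpace ℝ (Fin d)) (w : EuclideanSpace ℝ (Fin d))
    (h : n * logisticLossD d n x w ≤ Real.log 2) :
    logisticLossD d n x w ≤ 2 * gradPotentialD d n x w := by
  have hn' : (0 : ℝ) < n := by exact_mod_cast hn
  rw [logisticLossD, mul_inv_cancel_left₀ hn'.ne'] at h
  rw [logisticLossD, gradPotentialD, mul_left_comm, Finset.mul_sum _ _ (2 : ℝ)]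
  gcongr with i
  refine log_le_two_mul_inv_exp_add_one _ (le_trans ?_ h)
  exact Finset.single_le_sum
    (f := fun j => Real.log (1 + Real.exp (-⟪w, x j⟫_ℝ)))
    (fun j _ => Real.log_nonneg (by linarith [Real.exp_pos (-⟪w, x j⟫_ℝ)])) (Finset.mem_univ i)

/-- The negative gradient of the logistic loss. -/
noncomputable def negGradD (d n : ℕ) (x : Fin n → EuclideanSpace ℝ (Fin d))
    (w : EuclideanSpace ℝ (Fin d)) : EuclideanSpace ℝ (Fin d) :=
  (n : ℝ)⁻¹ • ∑ i, (Real.exp ⟪w, x i⟫_ℝ + 1)⁻¹ • x i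

lemma inner_negGradD {d n : ℕ} (x : Fin n → EuclideanSpace ℝ (Fin d))
    (v w : EuclideanSpace ℝ (Fin d)) :
    ⟪v, negGradD d n x w⟫_ℝ = (n : ℝ)⁻¹ * ∑ i, (Real.exp ⟪w, x i⟫_ℝ + 1)⁻¹ * ⟪v, x i⟫_ℝ := by
  simp only [negGradD, inner_smul_right, inner_sum]

lemma norm_negGradD_le {d n : ℕ} {x : Fin n → EuclideanSpace ℝ (Fin d)}
    (hx : ∀ i, ‖x i‖ ≤ 1) (w : EuclideanSpace ℝ (Fin d)) :
    ‖negGradD d n x w‖ ≤ gradPotentialD d n x w := by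
  rw [negGradD, norm_smul, Real.norm_of_nonneg (by positivity), gradPotentialD]
  refine mul_le_mul_of_nonneg_left ((norm_sum_le _ _).trans (Finset.sum_le_sum fun i _ => ?_))
    (by positivity)
  have hp : 0 ≤ (Real.exp ⟪w, x i⟫_ℝ + 1)⁻¹ := by positivity
  rw [norm_smul, Real.norm_of_nonneg hp]
  exact mul_le_of_le_one_right hp (hx i)

lemma margin_mul_gradPotentialD_le {d n : ℕ} {x : Fin n → EuclideanSpace ℝ (Fin d)} {γ : ℝ}
    {v : EuclideanSpace ℝ (Fin d)} (hv : ‖v‖ = 1) (hsep : ∀ i, γ ≤ ⟪v, x i⟫_ℝ)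
    (w : EuclideanSpace ℝ (Fin d)) :
    γ * gradPotentialD d n x w ≤ ‖negGradD d n x w‖ := by
  calc γ * gradPotentialD d n x w ≤ ⟪v, negGradD d n x w⟫_ℝ := by
        rw [inner_negGradD, gradPotentialD, mul_left_comm, Finset.mul_sum]
        refine mul_le_mul_of_nonneg_left (Finset.sum_le_sum fun i _ => ?_) (by positivity)
        rw [mul_comm]
        exact mul_le_mul_of_nonneg_left (hsep i) (by positivity)
    _ ≤ ‖v‖ * ‖negGradD d n x w‖ := real_inner_le_norm _ _
    _ = ‖negGradD d n x w‖ := by rw [hv, one_mul]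

/-- Local smoothness of the logistic loss, with the gradient potential as smoothness constant. -/
lemma logisticLossD_add_le {d n : ℕ} {x : Fin n → EuclideanSpace ℝ (Fin d)}
    (hx : ∀ i, ‖x i‖ ≤ 1) (w v : EuclideanSpace ℝ (Fin d)) (hv : ‖v‖ ≤ 1) :
    logisticLossD d n x (w + v) ≤ logisticLossD d n x w - ⟪v, negGradD d n x w⟫_ℝ
      + gradPotentialD d n x w * ‖v‖ ^ 2 := by
  rw [inner_negGradD, logisticLossD, logisticLossD, gradPotentialD, mul_assoc, ← mul_sub,
    ← mul_add, Finset.sum_mul, ← Finset.sum_sub_distrib, ← Finset.sum_add_distrib]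
  refine mul_le_mul_of_nonneg_left (Finset.sum_le_sum fun i _ => ?_) (by positivity)
  have hin : |⟪v, x i⟫_ℝ| ≤ ‖v‖ :=
    (abs_real_inner_le_norm _ _).trans (mul_le_of_le_one_right (norm_nonneg _) (hx i))
  have hsq : ⟪v, x i⟫_ℝ ^ 2 ≤ ‖v‖ ^ 2 := sq_le_sq' (abs_le.mp hin).1 (abs_le.mp hin).2
  have hscalar := log_one_add_exp_neg_add_le ⟪w, x i⟫_ℝ ⟪v, x i⟫_ℝ (hin.trans hv)
  have hmul := mul_le_mul_of_nonneg_left hsq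
    (by positivity : 0 ≤ (Real.exp ⟪w, x i⟫_ℝ + 1)⁻¹)
  rw [inner_add_left]
  linarith

/-- One gradient step from a point of small loss decreases the loss quadratically. -/
lemma logisticLossD_step_le {d n : ℕ} (hn : 0 < n) {x : Fin n → EuclideanSpace ℝ (Fin d)}
    (hx : ∀ i, ‖x i‖ ≤ 1) {γ : ℝ} (hγ : 0 ≤ γ) {v : EuclideanSpace ℝ (Fin d)} (hv : ‖v‖ = 1)
    (hsep : ∀ i, γ ≤ ⟪v, x i⟫_ℝ) {η : ℝ} (hη : (n : ℝ) ≤ η) (w : EuclideanSpace ℝ (Fin d))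
    (hw : logisticLossD d n x w ≤ 1 / (8 * η)) :
    logisticLossD d n x (w + η • negGradD d n x w)
      ≤ logisticLossD d n x w - η * γ ^ 2 / 8 * logisticLossD d n x w ^ 2 := by
  have hn' : (0 : ℝ) < n := by exact_mod_cast hn
  have hη0 : 0 < η := hn'.trans_le hη
  have hF := logisticLossD_pos hn x w
  have hG := gradPotentialD_nonneg x w
  have hGF := gradPotentialD_le_logisticLossD x w
  have hηF : η * logisticLossD d n x w ≤ 1 / 8 := by
    rw [le_div_iff₀ (by positivity)] at hw
    linarith
  have hFG : logisticLossD d n x w ≤ 2 * gradPotentialD d n x w := by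
    refine logisticLossD_le_two_mul_gradPotentialD hn x w ?_
    have := mul_le_mul_of_nonneg_right hη hF.le
    linarith [Real.log_two_gt_d9]
  have hηG : η * gradPotentialD d n x w ≤ 1 / 8 :=
    (mul_le_mul_of_nonneg_left hGF hη0.le).trans hηF
  have hg := mul_le_mul_of_nonneg_left (norm_negGradD_le hx w) hη0.le
  have hnorm : ‖η • negGradD d n x w‖ = η * ‖negGradD d n x w‖ := by
    rw [norm_smul, Real.norm_of_nonneg hη0.le]
  have hstep := logisticLossD_add_le hx w (η • negGradD d n x w) (by linarith)
  rw [hnorm, real_inner_smul_left, real_inner_self_eq_norm_sq] at hstep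
  have hlower : γ ^ 2 * logisticLossD d n x w ^ 2 ≤ 4 * ‖negGradD d n x w‖ ^ 2 := by
    have h : γ * logisticLossD d n x w ≤ 2 * ‖negGradD d n x w‖ := by
      have := mul_le_mul_of_nonneg_left hFG hγ
      linarith [margin_mul_gradPotentialD_le hv hsep w]
    have := pow_le_pow_left₀ (mul_nonneg hγ hF.le) h 2
    linarith [mul_pow γ (logisticLossD d n x w) 2, mul_pow 2 ‖negGradD d n x w‖ 2]
  have hquad : gradPotentialD d n x w * (η * ‖negGradD d n x w‖) ^ 2
      ≤ 1 / 8 * (η * ‖negGradD d n x w‖ ^ 2) := by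
    have := mul_le_mul_of_nonneg_right hηG
      (by positivity : 0 ≤ η * ‖negGradD d n x w‖ ^ 2)
    linarith
  have hmain := mul_le_mul_of_nonneg_left hlower hη0.le
  have : 0 ≤ η * ‖negGradD d n x w‖ ^ 2 := by positivity
  linarith

/-- The recursion `a (k + 1) ≤ a k - c * a k ^ 2` forces `a k ≤ 1 / (c * k)`. -/
lemma mul_mul_le_one_of_quadratic_decrease {a : ℕ → ℝ} {c : ℝ} (hc : 0 ≤ c)
    (ha : ∀ k, 0 < a k) (hstep : ∀ k, a (k + 1) ≤ a k - c * a k ^ 2) (k : ℕ) :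
    a k * (c * k) ≤ 1 := by
  induction k with
  | zero => simp
  | succ k ih =>
    have h0 := ha k
    have h1 := ha (k + 1)
    have hca : 0 ≤ c * a k := by positivity
    have hle : a (k + 1) * (1 + c * a k) ≤ a k := by
      have := mul_le_mul_of_nonneg_right (hstep k) (by linarith : 0 ≤ 1 + c * a k)
      have : 0 ≤ a k * (c * a k) ^ 2 := by positivity
      linarith
    have hih := mul_le_mul_of_nonneg_left ih h1.le
    refine le_of_mul_le_mul_left ?_ h0
    push_cast
    linarith

theorem stmt_11 (d n : ℕ) (hn : 0 < n) (x : Fin n → EuclideanSpace ℝ (Fin d))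
    (hx : ∀ i, ‖x i‖ ≤ 1) (γ : ℝ) (hγ0 : 0 < γ) (hγ1 : γ < 1)
    (hmm : isMaxMarginD d n x γ)
    (wst : EuclideanSpace ℝ (Fin d)) (hws : ‖wst‖ = 1) (hsep : ∀ i, γ ≤ ⟪wst, x i⟫_ℝ)
    (η : ℝ) (hη : (n : ℝ) ≤ η)
    (w : ℕ → EuclideanSpace ℝ (Fin d))
    (hstep : ∀ t : ℕ, w (t + 1) = w t
      + (η / n) • ∑ i, (Real.exp ⟪w t, x i⟫_ℝ + 1)⁻¹ • x i)
    (T : ℕ) (hT : logisticLossD d n x (w T) ≤ 1 / (8 * η)) :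
    (∀ t : ℕ, T ≤ t → logisticLossD d n x (w (t + 1)) ≤ logisticLossD d n x (w t)) ∧
    (∀ t : ℕ, T < t →
      logisticLossD d n x (w t) ≤ 8 / (η * γ ^ 2 * ((t : ℝ) - (T : ℝ)))) := by
  have hn' : (0 : ℝ) < n := by exact_mod_cast hn
  have hη0 : 0 < η := hn'.trans_le hη
  have hw : ∀ t, w (t + 1) = w t + η • negGradD d n x (w t) := fun t => by
    rw [hstep t, negGradD, smul_smul, div_eq_mul_inv]
  have hdec : ∀ t, logisticLossD d n x (w t) ≤ 1 / (8 * η) →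
      logisticLossD d n x (w (t + 1)) ≤ logisticLossD d n x (w t)
        - η * γ ^ 2 / 8 * logisticLossD d n x (w t) ^ 2 := fun t ht => by
    rw [hw t]
    exact logisticLossD_step_le hn hx hγ0.le hws hsep hη (w t) ht
  have hmono : ∀ t, logisticLossD d n x (w t) ≤ 1 / (8 * η) →
      logisticLossD d n x (w (t + 1)) ≤ logisticLossD d n x (w t) := fun t ht =>
    (hdec t ht).trans (sub_le_self _ (by positivity))
  have hsmall : ∀ t, T ≤ t → logisticLossD d n x (w t) ≤ 1 / (8 * η) := fun t ht => by
    induction t, ht using Nat.le_induction with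
    | base => exact hT
    | succ t _ ih => exact (hmono t ih).trans ih
  refine ⟨fun t ht => hmono t (hsmall t ht), fun t ht => ?_⟩
  obtain ⟨k, rfl⟩ := Nat.exists_eq_add_of_lt ht
  have hrate := mul_mul_le_one_of_quadratic_decrease
    (a := fun k => logisticLossD d n x (w (T + k))) (c := η * γ ^ 2 / 8) (by positivity)
    (fun _ => logisticLossD_pos hn x _)
    (fun k => hdec (T + k) (hsmall (T + k) (Nat.le_add_right T k))) (k + 1)
  have hcast : ((T + k + 1 : ℕ) : ℝ) - T = k + 1 := by
    push_cast
    ring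
  rw [hcast, le_div_iff₀ (by positivity)]
  rw [← add_assoc] at hrate
  push_cast at hrate
  linarith
end

section
/- Suppose γ ≤ 1/6, n ≥ 2, and η ≥ η₁ = max(n, (32/γ²)·log(3/γ)). Then there exists a dataset x_1, …, x_n in ℝ² with ‖x_i‖ ≤ 1 for all i and maximum margin γ, such that the gradient descent iterates satisfy F(w_t) > 2/η for all t ≤ 1 + 1/(59γ²). -/
open scoped InnerProductSpace BigOperators
open Finset

/-- A sum over a two-cluster dataset: `k` copies of `A` followed by `n - k` copies of `B`. -/
theorem sum_two_clusters {E : Type*} {M : Type*} [AddCommMonoid M] {n k : ℕ} (hk : k ≤ n)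
    (f : E → M) (A B : E) :
    ∑ i : Fin n, f (if i.val < k then A else B) = k • f A + (n - k) • f B := by
  have h := Fin.sum_univ_eq_sum_range (fun i => f (if i < k then A else B)) n
  rw [h, ← Finset.sum_range_add_sum_Ico _ hk]
  congr 1
  · rw [Finset.sum_congr rfl (g := fun _ => f A), Finset.sum_const, Finset.card_range]
    intro i hi
    rw [if_pos (Finset.mem_range.1 hi)]
  · rw [Finset.sum_congr rfl (g := fun _ => f B), Finset.sum_const, Nat.card_Ico]
    intro i hi
    rw [if_neg (not_lt.2 (Finset.mem_Ico.1 hi).1)]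

theorem inv_exp_add_one_nonneg (z : ℝ) : 0 ≤ (Real.exp z + 1)⁻¹ := by positivity

theorem inv_exp_add_one_le_one (z : ℝ) : (Real.exp z + 1)⁻¹ ≤ 1 :=
  inv_le_one_of_one_le₀ (by linarith [Real.exp_pos z])

theorem inv_exp_add_one_le_exp_neg {z m : ℝ} (h : m ≤ z) :
    (Real.exp z + 1)⁻¹ ≤ Real.exp (-m) := by
  rw [Real.exp_neg]
  exact inv_anti₀ (Real.exp_pos m) (by linarith [Real.exp_le_exp.2 h])

theorem one_sub_exp_neg_le_inv_exp_add_one {z m : ℝ} (h : z ≤ -m) :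
    1 - Real.exp (-m) ≤ (Real.exp z + 1)⁻¹ := by
  have hz := Real.exp_pos z
  have h1 : 1 - Real.exp z ≤ (Real.exp z + 1)⁻¹ := by
    rw [inv_eq_one_div, le_div_iff₀ (by linarith)]
    nlinarith
  linarith [Real.exp_le_exp.2 h]

theorem log_one_add_exp_nonneg (z : ℝ) : 0 ≤ Real.log (1 + Real.exp z) :=
  Real.log_nonneg (by linarith [Real.exp_pos z])

theorem le_log_one_add_exp (z : ℝ) : z ≤ Real.log (1 + Real.exp z) := by
  rw [Real.le_log_iff_exp_le (by positivity)]
  linarith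

theorem inner_vec_two (a b c d : ℝ) :
    ⟪(!₂[a, b] : EuclideanSpace ℝ (Fin 2)), !₂[c, d]⟫_ℝ = a * c + b * d := by
  simp [PiLp.inner_apply, Fin.sum_univ_two, mul_comm]

/-- The dataset with `k` copies of `A` followed by `n - k` copies of `B`. -/
def twoClusters (n k : ℕ) (A B : EuclideanSpace ℝ (Fin 2)) (i : Fin n) :
    EuclideanSpace ℝ (Fin 2) :=
  if i.val < k then A else B

theorem logisticLoss_twoClusters {n k : ℕ} (hn : 0 < n) (hk : k ≤ n)
    (A B w : EuclideanSpace ℝ (Fin 2)) :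
    logisticLoss n (twoClusters n k A B) w =
      (k / n : ℝ) * Real.log (1 + Real.exp (-⟪w, A⟫_ℝ))
        + (1 - k / n : ℝ) * Real.log (1 + Real.exp (-⟪w, B⟫_ℝ)) := by
  have hn' : (n : ℝ) ≠ 0 := by positivity
  have h := sum_two_clusters hk (fun x => Real.log (1 + Real.exp (-⟪w, x⟫_ℝ))) A B
  unfold logisticLoss twoClusters
  rw [h]
  simp only [nsmul_eq_mul, Nat.cast_sub hk]
  field_simp

theorem gdIter_twoClusters_succ {n k : ℕ} (hn : 0 < n) (hk : k ≤ n)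
    (A B : EuclideanSpace ℝ (Fin 2)) (η : ℝ) (t : ℕ) (w : EuclideanSpace ℝ (Fin 2))
    (hw : gdIter n (twoClusters n k A B) η t = w) :
    gdIter n (twoClusters n k A B) η (t + 1) =
      w + ((η * (k / n : ℝ) * (Real.exp ⟪w, A⟫_ℝ + 1)⁻¹) • A
        + (η * (1 - k / n : ℝ) * (Real.exp ⟪w, B⟫_ℝ + 1)⁻¹) • B) := by
  have hn' : (n : ℝ) ≠ 0 := by positivity
  have h := sum_two_clusters hk (fun x => (Real.exp ⟪w, x⟫_ℝ + 1)⁻¹ • x) A B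
  rw [gdIter, hw]
  unfold twoClusters
  rw [h, ← Nat.cast_smul_eq_nsmul ℝ, ← Nat.cast_smul_eq_nsmul ℝ, Nat.cast_sub hk]
  simp only [smul_add, smul_smul]
  congr 3 <;> field_simp

theorem isMaxMargin_twoClusters {n k : ℕ} (hk0 : 0 < k) (hk : k < n) {γ a b : ℝ} (hγ : 0 ≤ γ)
    (ha : 0 < a) (hb : 0 < b) :
    isMaxMargin n (twoClusters n k !₂[γ, a] !₂[γ, -b]) γ := by
  constructor
  · refine ⟨!₂[1, 0], by simp [EuclideanSpace.norm_eq, Fin.sum_univ_two], fun i => ?_⟩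
    unfold twoClusters
    split_ifs <;> rw [inner_vec_two] <;> linarith
  · rintro m ⟨w, hw, hm⟩
    have hA := hm ⟨0, by omega⟩
    have hB := hm ⟨k, hk⟩
    simp only [twoClusters, hk0, lt_irrefl, if_true, if_false] at hA hB
    have hw0 : w 0 ≤ 1 := by
      have := PiLp.norm_apply_le w 0
      rw [hw] at this
      exact (le_abs_self _).trans this
    simp only [PiLp.inner_apply, Fin.sum_univ_two, RCLike.inner_apply, conj_trivial,
      Matrix.cons_val_zero, Matrix.cons_val_one] at hA hB
    have h1 : (a + b) * m ≤ (a + b) * (γ * w 0) := by nlinarith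
    have h2 := le_of_mul_le_mul_left h1 (by linarith)
    nlinarith

/-- `v` is within `e` of one of the points `-1/2`, `1/2`, `3/2`, between which the normalized
oscillating coordinate cycles. -/
def NearCycle (v e : ℝ) : Prop :=
  |v - 1 / 2| ≤ e ∨ |v - 3 / 2| ≤ e ∨ |v + 1 / 2| ≤ e

theorem NearCycle.sign {v e : ℝ} (h : NearCycle v e) (he : e ≤ 1 / 100) :
    49 / 100 ≤ v ∨ v ≤ -(49 / 100) := by
  rcases h with h | h | h <;> rw [abs_le] at h
  · left; linarith
  · left; linarith
  · right; linarith

theorem NearCycle.step {v e ε p q : ℝ} (h : NearCycle v e) (he : e ≤ 1 / 100)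
    (hp0 : 0 ≤ p) (hp1 : p ≤ 1) (hq0 : 0 ≤ q) (hq1 : q ≤ 1)
    (hpos : 49 / 100 ≤ v → p ≤ ε ∧ 1 - ε ≤ q) (hneg : v ≤ -(49 / 100) → 1 - ε ≤ p ∧ q ≤ ε) :
    NearCycle (v + 2 * p - q) (e + 3 * ε) := by
  rcases h with h | h | h <;> rw [abs_le] at h
  · obtain ⟨h1, h2⟩ := hpos (by linarith)
    right; right; rw [abs_le]; constructor <;> linarith
  · obtain ⟨h1, h2⟩ := hpos (by linarith)
    left; rw [abs_le]; constructor <;> linarith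
  · obtain ⟨h1, h2⟩ := hneg (by linarith)
    right; left; rw [abs_le]; constructor <;> linarith

/-- The margins of the two clusters at a point whose oscillating coordinate is bounded away
from zero. -/
theorem margins_of_sign {η α β g v : ℝ} (hη : 0 ≤ η) (hα : 35 / 288 ≤ α) (hβ : 35 / 288 ≤ β)
    (hg0 : 0 ≤ g) (hg : g ≤ 1 / 72 + 1 / 59) :
    (49 / 100 ≤ v → η / 50 ≤ η * (g + α * v) ∧ η * (g - β * v) ≤ -(η / 50)) ∧
    (v ≤ -(49 / 100) → η * (g + α * v) ≤ -(η / 50) ∧ η / 50 ≤ η * (g - β * v)) := by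
  refine ⟨fun hv => ?_, fun hv => ?_⟩
  · have h1 : 1 / 50 ≤ g + α * v := by nlinarith
    have h2 : g - β * v ≤ -(1 / 50) := by nlinarith
    constructor <;> nlinarith
  · have h1 : g + α * v ≤ -(1 / 50) := by nlinarith
    have h2 : 1 / 50 ≤ g - β * v := by nlinarith
    constructor <;> nlinarith

theorem eighty_div_sq_le {γ η : ℝ} (hγ0 : 0 < γ) (hγ : γ ≤ 1 / 6)
    (hη : 32 / γ ^ 2 * Real.log (3 / γ) ≤ η) : 80 / γ ^ 2 ≤ η := by
  have h16 : Real.log 16 = 4 * Real.log 2 := by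
    rw [show (16 : ℝ) = 2 ^ 4 by norm_num, Real.log_pow]; norm_num
  have hlog : 5 / 2 ≤ Real.log (3 / γ) := by
    have h : Real.log 16 ≤ Real.log (3 / γ) := by
      apply Real.log_le_log (by norm_num)
      rw [le_div_iff₀ hγ0]; linarith
    linarith [Real.log_two_gt_d9]
  refine le_trans ?_ hη
  calc 80 / γ ^ 2 = 32 / γ ^ 2 * (5 / 2) := by ring
    _ ≤ _ := by gcongr

theorem exp_neg_le_sq_div {γ η : ℝ} (hγ0 : 0 < γ) (hγ : γ ≤ 1 / 6) (hη : 80 / γ ^ 2 ≤ η) :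
    Real.exp (-(η / 50)) ≤ γ ^ 2 / 40 := by
  have hγ2 : 0 < γ ^ 2 := by positivity
  have hsq : γ ^ 2 ≤ 1 / 36 := by nlinarith
  rw [div_le_iff₀ hγ2] at hη
  have hη0 : 0 < η := by nlinarith
  have hq := Real.quadratic_le_exp_of_nonneg (x := η / 50) (by positivity)
  have hη' : 2880 ≤ η := by nlinarith
  have hlin : η / 2 ≤ Real.exp (η / 50) := by nlinarith
  rw [Real.exp_neg, inv_le_comm₀ (Real.exp_pos _) (by positivity), inv_div,
    div_le_iff₀ hγ2]
  nlinarith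

/-- After `t + 1` steps, the iterate in coordinates rescaled by `η * γ` and `η * δ`. -/
theorem gdIter_invariant {n k : ℕ} (hn : 0 < n) (hk : k ≤ n) {γ η a b δ : ℝ} (hγ0 : 0 < γ)
    (hγ : γ ≤ 1 / 6) (hη : 80 / γ ^ 2 ≤ η) (hδa : (k / n : ℝ) * a = 2 * δ)
    (hδb : (1 - k / n : ℝ) * b = δ) (hα : 35 / 288 ≤ a * δ) (hβ : 35 / 288 ≤ b * δ) (t : ℕ)
    (ht : t * γ ^ 2 ≤ 1 / 59) :
    ∃ y v : ℝ, gdIter n (twoClusters n k !₂[γ, a] !₂[γ, -b]) η (t + 1)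
        = !₂[η * γ * y, η * δ * v] ∧
      0 ≤ y ∧ y ≤ t + 1 / 2 ∧ NearCycle v (t * (3 * Real.exp (-(η / 50)))) := by
  have hp0 : 0 ≤ (k / n : ℝ) := by positivity
  have hp1 : (k / n : ℝ) ≤ 1 := div_le_one_of_le₀ (by exact_mod_cast hk) (by positivity)
  generalize hp : (k / n : ℝ) = p at *
  induction t with
  | zero =>
    refine ⟨1 / 2, 1 / 2, ?_, by norm_num, by norm_num, ?_⟩
    · rw [gdIter_twoClusters_succ hn hk _ _ η 0 0 rfl, hp]
      ext i
      fin_cases i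
      · simp
        ring
      · simp
        linear_combination (η / 2) * hδa - (η / 2) * hδb
    · left; simp
  | succ t ih =>
    have hγ2 : 0 < γ ^ 2 := by positivity
    push_cast at ht
    obtain ⟨y, v, hw, hy0, hy, hv⟩ := ih (by nlinarith)
    have hη0 : 0 ≤ η := le_trans (by positivity) hη
    have hε := exp_neg_le_sq_div hγ0 hγ hη
    set ε := Real.exp (-(η / 50)) with hεdef
    have he : t * (3 * ε) ≤ 1 / 100 := by
      have : (t : ℝ) * ε ≤ t * (γ ^ 2 / 40) := by gcongr
      nlinarith
    have hg : γ ^ 2 * y ≤ 1 / 72 + 1 / 59 := by nlinarith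
    obtain ⟨hpos, hneg⟩ := margins_of_sign (v := v) hη0 hα hβ (by positivity) hg
    have hA : ⟪(!₂[η * γ * y, η * δ * v] : EuclideanSpace ℝ (Fin 2)), !₂[γ, a]⟫_ℝ
        = η * (γ ^ 2 * y + a * δ * v) := by rw [inner_vec_two]; ring
    have hB : ⟪(!₂[η * γ * y, η * δ * v] : EuclideanSpace ℝ (Fin 2)), !₂[γ, -b]⟫_ℝ
        = η * (γ ^ 2 * y - b * δ * v) := by rw [inner_vec_two]; ring
    have hstep := gdIter_twoClusters_succ hn hk _ _ η (t + 1) _ hw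
    rw [hA, hB, hp] at hstep
    have hv' := hv.step (ε := ε) he
      (inv_exp_add_one_nonneg (η * (γ ^ 2 * y + a * δ * v))) (inv_exp_add_one_le_one _)
      (inv_exp_add_one_nonneg (η * (γ ^ 2 * y - b * δ * v))) (inv_exp_add_one_le_one _)
      (fun h => ⟨inv_exp_add_one_le_exp_neg (hpos h).1,
        one_sub_exp_neg_le_inv_exp_add_one (hpos h).2⟩)
      (fun h => ⟨one_sub_exp_neg_le_inv_exp_add_one (hneg h).1,
        inv_exp_add_one_le_exp_neg (hneg h).2⟩)
    have hσA0 := inv_exp_add_one_nonneg (η * (γ ^ 2 * y + a * δ * v))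
    have hσA1 := inv_exp_add_one_le_one (η * (γ ^ 2 * y + a * δ * v))
    have hσB0 := inv_exp_add_one_nonneg (η * (γ ^ 2 * y - b * δ * v))
    have hσB1 := inv_exp_add_one_le_one (η * (γ ^ 2 * y - b * δ * v))
    generalize (Real.exp (η * (γ ^ 2 * y + a * δ * v)) + 1)⁻¹ = σA at *
    generalize (Real.exp (η * (γ ^ 2 * y - b * δ * v)) + 1)⁻¹ = σB at *
    refine ⟨y + p * σA + (1 - p) * σB, v + 2 * σA - σB, ?_, ?_, ?_, ?_⟩
    · rw [hstep]
      ext i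
      fin_cases i
      · simp
        ring
      · simp
        linear_combination (η * σA) * hδa - (η * σB) * hδb
    · have := mul_nonneg hp0 hσA0
      have := mul_nonneg (sub_nonneg.2 hp1) hσB0
      linarith
    · have := mul_le_mul_of_nonneg_left hσA1 hp0
      have := mul_le_mul_of_nonneg_left hσB1 (sub_nonneg.2 hp1)
      push_cast
      linarith
    · convert hv' using 1
      push_cast
      ring

theorem two_div_lt_logisticLoss_twoClusters {n k : ℕ} (hn : 0 < n) (hk : k ≤ n)
    {γ η a b δ : ℝ} (hγ0 : 0 < γ)
    (hγ : γ ≤ 1 / 6) (hη : 80 / γ ^ 2 ≤ η) (hp : 1 / 3 ≤ (k / n : ℝ))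
    (hp' : (k / n : ℝ) ≤ 2 / 3) (hδa : (k / n : ℝ) * a = 2 * δ)
    (hδb : (1 - k / n : ℝ) * b = δ) (hα : 35 / 288 ≤ a * δ) (hβ : 35 / 288 ≤ b * δ) (t : ℕ)
    (ht : (t : ℝ) ≤ 1 + 1 / (59 * γ ^ 2)) :
    2 / η < logisticLoss n (twoClusters n k !₂[γ, a] !₂[γ, -b])
      (gdIter n (twoClusters n k !₂[γ, a] !₂[γ, -b]) η t) := by
  have hγ2 : 0 < γ ^ 2 := by positivity
  have hsq : γ ^ 2 ≤ 1 / 36 := by nlinarith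
  have hη' : 2880 ≤ η := by
    rw [div_le_iff₀ hγ2] at hη
    nlinarith
  have hη0 : 0 < η := by linarith
  have h2η : 2 / η ≤ 1 / 1440 := by
    rw [div_le_iff₀ hη0]; linarith
  rw [logisticLoss_twoClusters hn hk]
  cases t with
  | zero =>
    simp only [gdIter, inner_zero_left, neg_zero, Real.exp_zero]
    rw [show (1 + 1 : ℝ) = 2 by norm_num]
    linarith [Real.log_two_gt_d9]
  | succ t =>
    have ht' : t * γ ^ 2 ≤ 1 / 59 := by
      push_cast at ht
      have h : (t : ℝ) ≤ 1 / (59 * γ ^ 2) := by linarith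
      rw [le_div_iff₀ (by positivity)] at h
      linarith
    obtain ⟨y, v, hw, hy0, hy, hv⟩ :=
      gdIter_invariant hn hk hγ0 hγ hη hδa hδb hα hβ t ht'
    have hε := exp_neg_le_sq_div hγ0 hγ hη
    have he : t * (3 * Real.exp (-(η / 50))) ≤ 1 / 100 := by
      have : (t : ℝ) * Real.exp (-(η / 50)) ≤ t * (γ ^ 2 / 40) := by gcongr
      nlinarith
    have hg : γ ^ 2 * y ≤ 1 / 72 + 1 / 59 := by nlinarith
    obtain ⟨hpos, hneg⟩ := margins_of_sign (v := v) hη0.le hα hβ (by positivity) hg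
    rw [hw, inner_vec_two, inner_vec_two,
      show η * γ * y * γ + η * δ * v * a = η * (γ ^ 2 * y + a * δ * v) by ring,
      show η * γ * y * γ + η * δ * v * -b = η * (γ ^ 2 * y - b * δ * v) by ring]
    have hA0 := log_one_add_exp_nonneg (-(η * (γ ^ 2 * y + a * δ * v)))
    have hB0 := log_one_add_exp_nonneg (-(η * (γ ^ 2 * y - b * δ * v)))
    have hA := le_log_one_add_exp (-(η * (γ ^ 2 * y + a * δ * v)))
    have hB := le_log_one_add_exp (-(η * (γ ^ 2 * y - b * δ * v)))
    rcases hv.sign he with h | h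
    · have := (hpos h).2
      nlinarith
    · have := (hneg h).1
      nlinarith

theorem stmt_13 (n : ℕ) (hn : 2 ≤ n) (γ : ℝ) (hγ0 : 0 < γ) (hγ : γ ≤ 1 / 6)
    (η : ℝ) (hη : max (n : ℝ) (32 / γ ^ 2 * Real.log (3 / γ)) ≤ η) :
    ∃ x : Fin n → EuclideanSpace ℝ (Fin 2),
      (∀ i, ‖x i‖ ≤ 1) ∧ isMaxMargin n x γ ∧
      ∀ t : ℕ, (t : ℝ) ≤ 1 + 1 / (59 * γ ^ 2) →
        2 / η < logisticLoss n x (gdIter n x η t) := by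
  obtain ⟨k, hk2, hk3⟩ : ∃ k : ℕ, n ≤ 2 * k ∧ 3 * k ≤ 2 * n := ⟨(n + 1) / 2, by omega, by omega⟩
  have hn0 : (0 : ℝ) < n := by positivity
  have hp : 1 / 2 ≤ (k / n : ℝ) := by
    rw [le_div_iff₀ hn0]
    have : (n : ℝ) ≤ 2 * k := by exact_mod_cast hk2
    linarith
  have hp' : (k / n : ℝ) ≤ 2 / 3 := by
    rw [div_le_iff₀ hn0]
    have : (3 * k : ℝ) ≤ 2 * n := by exact_mod_cast hk3
    linarith
  have hη' := eighty_div_sq_le hγ0 hγ (le_trans (le_max_right _ _) hη)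
  obtain ⟨s, hs0, hs⟩ : ∃ s : ℝ, 0 < s ∧ s ^ 2 = 1 - γ ^ 2 :=
    ⟨√(1 - γ ^ 2), Real.sqrt_pos.2 (by nlinarith), Real.sq_sqrt (by nlinarith)⟩
  have hs2 : 35 / 36 ≤ s ^ 2 := by nlinarith
  obtain ⟨r, hr⟩ : ∃ r : ℝ, (1 - k / n : ℝ) * r = k / n / 2 :=
    ⟨k / n / 2 / (1 - k / n), mul_div_cancel₀ _ (by linarith)⟩
  have hr1 : 1 / 2 ≤ r := by nlinarith
  have hr2 : r ≤ 1 := by nlinarith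
  have hr3 : r ^ 2 ≤ 1 := by nlinarith
  refine ⟨twoClusters n k !₂[γ, s] !₂[γ, -(r * s)], fun i => ?_,
    isMaxMargin_twoClusters (by omega) (by omega) hγ0.le hs0 (by positivity), fun t ht =>
    two_div_lt_logisticLoss_twoClusters (δ := k / n / 2 * s) (by omega) (by omega) hγ0 hγ hη'
      (by linarith) hp' (by ring) (by linear_combination s * hr) (by nlinarith) ?_ t ht⟩
  · unfold twoClusters
    split_ifs <;> rw [EuclideanSpace.norm_eq, Real.sqrt_le_one] <;>
      simp [Fin.sum_univ_two, mul_pow] <;>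
      nlinarith [mul_nonneg (sub_nonneg.2 hr3) (sq_nonneg s)]
  · have : 1 / 8 ≤ r * (k / n / 2) := by nlinarith
    nlinarith
end

section
/- Let x_1, …, x_n ∈ ℝ^d and c > 0. If F(w) ≥ c, then G(w) ≥ (1 − exp(−nc))/n. If additionally c ≤ 1/n, then G(w) ≥ c/2. -/
open scoped InnerProductSpace BigOperators
open Finset

/-- The Weierstrass product inequality `1 - ∑ p i ≤ ∏ (1 - p i)` for `p i ∈ [0, 1]`. -/
theorem one_sub_sum_le_prod_one_sub {ι : Type*} (s : Finset ι) (p : ι → ℝ)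
    (h0 : ∀ i ∈ s, 0 ≤ p i) (h1 : ∀ i ∈ s, p i ≤ 1) :
    1 - ∑ i ∈ s, p i ≤ ∏ i ∈ s, (1 - p i) := by
  classical
  induction s using Finset.induction_on with
  | empty => simp
  | insert a s ha ih =>
    rw [Finset.forall_mem_insert] at h0 h1
    rw [Finset.sum_insert ha, Finset.prod_insert ha]
    have hs : 0 ≤ ∑ i ∈ s, p i := Finset.sum_nonneg h0.2
    nlinarith [mul_le_mul_of_nonneg_left (ih h0.2 h1.2) (sub_nonneg.2 h1.1),
      mul_nonneg h0.1 hs]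

theorem one_sub_inv_exp_add_one (t : ℝ) :
    1 - (Real.exp t + 1)⁻¹ = Real.exp (-Real.log (1 + Real.exp (-t))) := by
  have ht := Real.exp_pos t
  rw [Real.exp_neg, Real.exp_log (by positivity), Real.exp_neg]
  field_simp
  ring

/-- The sum of the logistic losses controls the sum of the gradient weights. -/
theorem one_sub_exp_neg_sum_log_le {ι : Type*} (s : Finset ι) (t : ι → ℝ) :
    1 - Real.exp (-∑ i ∈ s, Real.log (1 + Real.exp (-t i))) ≤
      ∑ i ∈ s, (Real.exp (t i) + 1)⁻¹ := by
  have h := one_sub_sum_le_prod_one_sub s (fun i => (Real.exp (t i) + 1)⁻¹)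
    (fun i _ => by positivity)
    (fun i _ => inv_le_one_of_one_le₀ (by linarith [Real.exp_pos (t i)]))
  simp only [one_sub_inv_exp_add_one] at h
  rw [← Real.exp_sum, Finset.sum_neg_distrib] at h
  linarith

theorem half_le_one_sub_exp_neg {u : ℝ} (h0 : 0 ≤ u) (h1 : u ≤ 1) :
    u / 2 ≤ 1 - Real.exp (-u) := by
  have h : Real.exp (-u) * (1 + u) ≤ 1 := by
    rw [Real.exp_neg, inv_mul_le_one₀ (Real.exp_pos u)]
    linarith [Real.add_one_le_exp u]
  nlinarith [Real.exp_pos (-u)]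

theorem stmt_14 (d n : ℕ) (x : Fin n → EuclideanSpace ℝ (Fin d))
    (w : EuclideanSpace ℝ (Fin d)) (c : ℝ) (hc : 0 < c)
    (hF : c ≤ logisticLossD d n x w) :
    (1 - Real.exp (-((n : ℝ) * c))) / n ≤ gradPotentialD d n x w ∧
    (c ≤ 1 / n → c / 2 ≤ gradPotentialD d n x w) := by
  have hn : 0 < (n : ℝ) := by
    rcases Nat.eq_zero_or_pos n with rfl | hn
    · simp [logisticLossD] at hF
      linarith
    · exact_mod_cast hn
  have hsum : n * c ≤ ∑ i, Real.log (1 + Real.exp (-⟪w, x i⟫_ℝ)) := by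
    rwa [logisticLossD, inv_mul_eq_div, le_div_iff₀' hn] at hF
  have hG : (1 - Real.exp (-((n : ℝ) * c))) / n ≤ gradPotentialD d n x w := by
    rw [gradPotentialD, inv_mul_eq_div]
    gcongr
    refine le_trans ?_ (one_sub_exp_neg_sum_log_le univ fun i => ⟪w, x i⟫_ℝ)
    gcongr
  refine ⟨hG, fun hcn => le_trans ?_ hG⟩
  rw [le_div_iff₀' hn] at hcn ⊢
  linarith [half_le_one_sub_exp_neg (by positivity) hcn]
end

section
/- Suppose γ ≤ 1/6, n ≥ 6, and η ≥ η₁ = max(n, (32/γ²)·log(3/γ)). Then there exists a dataset x_1, …, x_n in ℝ² with ‖x_i‖ ≤ 1 for all i and maximum margin γ, such that the time-averaged gradient potential of the gradient descent iterates satisfies (1/t)·∑_{s=0}^{t−1} G(w_s) ≥ 1/(8η) for all t with 1 ≤ t ≤ η/(8γ). In particular, the first time t at which (1/t)·∑_{s=0}^{t−1} G(w_s) ≤ 1/(8η) is at least Ω(η/γ). -/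
open scoped InnerProductSpace BigOperators
open Finset

/-- Data set with one point `u` and `m` copies of `v`. -/
noncomputable def onePointVersus (m : ℕ) (u v : EuclideanSpace ℝ (Fin 2)) :
    Fin (m + 1) → EuclideanSpace ℝ (Fin 2) :=
  Fin.cons u fun _ => v

theorem gradPotential_onePointVersus (m : ℕ) (u v w : EuclideanSpace ℝ (Fin 2)) :
    gradPotential (m + 1) (onePointVersus m u v) w =
      ((m + 1 : ℕ) : ℝ)⁻¹ * ((Real.exp ⟪w, u⟫_ℝ + 1)⁻¹ + m * (Real.exp ⟪w, v⟫_ℝ + 1)⁻¹) := by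
  simp [gradPotential, onePointVersus, Fin.sum_univ_succ]

theorem gdIter_onePointVersus (m : ℕ) (u v : EuclideanSpace ℝ (Fin 2)) (η : ℝ) (t : ℕ) :
    gdIter (m + 1) (onePointVersus m u v) η t = (η / (m + 1 : ℕ)) •
      ((∑ s ∈ range t,
          (Real.exp ⟪gdIter (m + 1) (onePointVersus m u v) η s, u⟫_ℝ + 1)⁻¹) • u +
        (m * ∑ s ∈ range t,
          (Real.exp ⟪gdIter (m + 1) (onePointVersus m u v) η s, v⟫_ℝ + 1)⁻¹) • v) := by
  induction t with
  | zero => simp [gdIter]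
  | succ t ih =>
    have step : gdIter (m + 1) (onePointVersus m u v) η (t + 1) =
        gdIter (m + 1) (onePointVersus m u v) η t + (η / (m + 1 : ℕ)) •
          ((Real.exp ⟪gdIter (m + 1) (onePointVersus m u v) η t, u⟫_ℝ + 1)⁻¹ • u +
            ((m : ℝ) * (Real.exp ⟪gdIter (m + 1) (onePointVersus m u v) η t, v⟫_ℝ + 1)⁻¹) • v) := by
      conv_lhs => rw [gdIter]
      rw [Fin.sum_univ_succ]
      simp [onePointVersus, ← Nat.cast_smul_eq_nsmul ℝ, smul_smul]
    rw [step, sum_range_succ, sum_range_succ]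
    nth_rewrite 1 [ih]
    module

theorem half_le_inv_exp_add_one {z : ℝ} (hz : z ≤ 0) : 1 / 2 ≤ (Real.exp z + 1)⁻¹ := by
  have h := Real.exp_le_one_iff.2 hz
  rw [one_div]
  exact inv_anti₀ (by positivity) (by linarith)

/-- While the margin of `u` is negative its gradient weight is at least `1 / 2`, so the
accumulated weight of `u` grows linearly until it balances the first step towards `v`. -/
theorem min_le_sum_weight (m : ℕ) (u v : EuclideanSpace ℝ (Fin 2)) {η K : ℝ} (hη : 0 ≤ η)
    (huv : ⟪v, u⟫_ℝ ≤ 0) (hK : K * ⟪u, u⟫_ℝ ≤ m / 2 * -⟪v, u⟫_ℝ) (t : ℕ) :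
    min ((t : ℝ) / 2) K ≤ ∑ s ∈ range t,
      (Real.exp ⟪gdIter (m + 1) (onePointVersus m u v) η s, u⟫_ℝ + 1)⁻¹ := by
  induction t with
  | zero => simp
  | succ t ih =>
    have hpos : 0 ≤ (Real.exp ⟪gdIter (m + 1) (onePointVersus m u v) η t, u⟫_ℝ + 1)⁻¹ := by
      positivity
    rw [sum_range_succ]
    by_cases hA : K ≤ ∑ s ∈ range t,
        (Real.exp ⟪gdIter (m + 1) (onePointVersus m u v) η s, u⟫_ℝ + 1)⁻¹
    · exact (min_le_right _ _).trans (by linarith)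
    · have hmargin : ⟪gdIter (m + 1) (onePointVersus m u v) η t, u⟫_ℝ ≤ 0 := by
        rcases t with _ | t
        · simp [gdIter]
        · have hB : 1 / 2 ≤ ∑ s ∈ range (t + 1),
              (Real.exp ⟪gdIter (m + 1) (onePointVersus m u v) η s, v⟫_ℝ + 1)⁻¹ := by
            rw [sum_range_succ']
            have h0 := half_le_inv_exp_add_one
              (z := ⟪gdIter (m + 1) (onePointVersus m u v) η 0, v⟫_ℝ) (by simp [gdIter])
            have : 0 ≤ ∑ s ∈ range t,
                (Real.exp ⟪gdIter (m + 1) (onePointVersus m u v) η (s + 1), v⟫_ℝ + 1)⁻¹ :=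
              sum_nonneg fun _ _ => by positivity
            linarith
          rw [gdIter_onePointVersus, real_inner_smul_left, inner_add_left,
            real_inner_smul_left, real_inner_smul_left]
          refine mul_nonpos_of_nonneg_of_nonpos (by positivity) ?_
          have h1 := mul_le_mul_of_nonneg_right (not_le.1 hA).le (real_inner_self_nonneg (x := u))
          have h2 := mul_le_mul_of_nonneg_right
            (mul_le_mul_of_nonneg_left hB (Nat.cast_nonneg (α := ℝ) m)) (neg_nonneg.2 huv)
          linarith
      have hstep := half_le_inv_exp_add_one hmargin
      have ht := (min_le_iff.1 ih).resolve_right hA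
      refine (min_le_left _ _).trans ?_
      push_cast
      linarith

theorem isMaxMargin_onePointVersus {m : ℕ} (hm : 0 < m) {γ a b : ℝ} (hγ : 0 ≤ γ) (ha : 0 < a)
    (hb : 0 < b) : isMaxMargin (m + 1) (onePointVersus m !₂[γ, -a] !₂[γ, b]) γ := by
  constructor
  · refine ⟨!₂[1, 0], by simp [EuclideanSpace.norm_eq], fun i => ?_⟩
    refine Fin.cases ?_ (fun j => ?_) i <;>
      simp [onePointVersus, EuclideanSpace.inner_eq_star_dotProduct]
  · rintro c ⟨w, hw, hc⟩
    have h0 := hc 0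
    have h1 := hc (Fin.succ ⟨0, hm⟩)
    simp only [onePointVersus, Fin.cons_zero, Fin.cons_succ, PiLp.inner_apply,
      Fin.sum_univ_two] at h0 h1
    simp at h0 h1
    have hw0 : w 0 ≤ 1 := by
      rw [← hw]
      exact (le_abs_self _).trans (PiLp.norm_apply_le w 0)
    have h2 := mul_le_mul_of_nonneg_left h0 hb.le
    have h3 := mul_le_mul_of_nonneg_left h1 ha.le
    have h4 : (a + b) * c ≤ (a + b) * (γ * w 0) := by linarith
    have h5 := le_of_mul_le_mul_left h4 (by positivity)
    nlinarith

theorem stmt_16 (n : ℕ) (hn : 6 ≤ n) (γ : ℝ) (hγ0 : 0 < γ) (hγ : γ ≤ 1 / 6)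
    (η : ℝ) (hη : max (n : ℝ) (32 / γ ^ 2 * Real.log (3 / γ)) ≤ η) :
    ∃ x : Fin n → EuclideanSpace ℝ (Fin 2),
      (∀ i, ‖x i‖ ≤ 1) ∧ isMaxMargin n x γ ∧
      (∀ t : ℕ, 1 ≤ t → (t : ℝ) ≤ η / (8 * γ) →
        1 / (8 * η) ≤ (t : ℝ)⁻¹ * ∑ s ∈ Finset.range t, gradPotential n x (gdIter n x η s)) ∧
      (∀ t : ℕ, 1 ≤ t →
        (t : ℝ)⁻¹ * ∑ s ∈ Finset.range t, gradPotential n x (gdIter n x η s) ≤ 1 / (8 * η) →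
        η / (8 * γ) < (t : ℝ)) := by
  obtain ⟨m, rfl⟩ : ∃ m, n = m + 1 := ⟨n - 1, by omega⟩
  have hm : (5 : ℝ) ≤ m := by exact_mod_cast (by omega : 5 ≤ m)
  have hnη : ((m + 1 : ℕ) : ℝ) ≤ η := (le_max_left _ _).trans hη
  have hn0 : (0 : ℝ) < (m + 1 : ℕ) := by positivity
  have hη0 : 0 < η := hn0.trans_le hnη
  set u : EuclideanSpace ℝ (Fin 2) := !₂[γ, -γ] with hu
  set v : EuclideanSpace ℝ (Fin 2) := !₂[γ, 1 / 2] with hv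
  have huu : ⟪u, u⟫_ℝ = 2 * γ ^ 2 := by
    simp only [hu, PiLp.inner_apply, Fin.sum_univ_two]
    simp
    ring
  have hvu : ⟪v, u⟫_ℝ = -(γ * (1 / 2 - γ)) := by
    simp [hu, hv, PiLp.inner_apply, Fin.sum_univ_two]
    ring
  have key : ∀ t : ℕ, 1 ≤ t → (t : ℝ) ≤ η / (8 * γ) →
      1 / (8 * η) < (t : ℝ)⁻¹ *
        ∑ s ∈ range t, gradPotential (m + 1) (onePointVersus m u v)
          (gdIter (m + 1) (onePointVersus m u v) η s) := by
    intro t ht htη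
    have ht0 : (0 : ℝ) < t := by exact_mod_cast ht
    have hA := min_le_sum_weight m u v (η := η) (K := m * (1 - 2 * γ) / (8 * γ)) hη0.le
      (by rw [hvu]; nlinarith) (by rw [huu, hvu]; field_simp; linarith) t
    have hG : ((m + 1 : ℕ) : ℝ)⁻¹ * ∑ s ∈ range t,
          (Real.exp ⟪gdIter (m + 1) (onePointVersus m u v) η s, u⟫_ℝ + 1)⁻¹ ≤
        ∑ s ∈ range t, gradPotential (m + 1) (onePointVersus m u v)
          (gdIter (m + 1) (onePointVersus m u v) η s) := by
      rw [mul_sum]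
      refine sum_le_sum fun s _ => ?_
      rw [gradPotential_onePointVersus]
      refine mul_le_mul_of_nonneg_left (le_add_of_nonneg_right ?_) (by positivity)
      positivity
    rw [inv_mul_eq_div, lt_div_iff₀ ht0]
    refine lt_of_lt_of_le ?_ hG
    rw [inv_mul_eq_div, lt_div_iff₀ hn0]
    rcases min_le_iff.1 hA with h | h
    · refine lt_of_lt_of_le ?_ h
      rw [one_div, inv_mul_eq_div, div_mul_eq_mul_div, div_lt_div_iff₀ (by positivity) two_pos]
      nlinarith [mul_pos ht0 hη0, mul_le_mul_of_nonneg_left hnη ht0.le]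
    · refine lt_of_lt_of_le ?_ h
      have h1 : 1 / (8 * η) * t ≤ 1 / (64 * γ) := by
        calc 1 / (8 * η) * t ≤ 1 / (8 * η) * (η / (8 * γ)) := by gcongr
          _ = 1 / (64 * γ) := by field_simp; norm_num
      calc 1 / (8 * η) * t * (m + 1 : ℕ) ≤ 1 / (64 * γ) * (m + 1 : ℕ) := by gcongr
        _ < m * (1 - 2 * γ) / (8 * γ) := by
          rw [one_div, inv_mul_eq_div, div_lt_div_iff₀ (by positivity) (by positivity)]
          push_cast
          nlinarith [mul_pos hγ0 (by linarith : (0 : ℝ) < m),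
            mul_nonneg (mul_nonneg hγ0.le (by linarith : (0 : ℝ) ≤ m)) (sub_nonneg.2 hγ)]
  refine ⟨onePointVersus m u v, fun i => ?_,
    isMaxMargin_onePointVersus (by omega) hγ0.le hγ0 (by norm_num),
    fun t ht htη => (key t ht htη).le, fun t ht hle => ?_⟩
  · refine Fin.cases ?_ (fun j => ?_) i <;>
      simp only [onePointVersus, Fin.cons_zero, Fin.cons_succ, hu, hv,
        EuclideanSpace.norm_eq, Fin.sum_univ_two, Real.sqrt_le_one] <;>
      simp <;> nlinarith
  · by_contra h
    exact (key t ht (not_lt.1 h)).not_ge hle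
end
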